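/- arXiv:1112.6061 — 6 statements merged into one kernel-verified Lean document; each statement's English description precedes it below -/
import Mathlib

section
/- Let r ≥ k > p > 1 be integers. Then C(k-1, p-1) · ((k+1)/2)^((k-p)/(k-1)) ≤ C(r-1, p-1) · C(r-1, k-1)^(−(p-1)/(k-1)) · 2^(k-1). -/
open Nat in
/-- For `m ≥ 5` the number `m! (m + 2) / 2` is at most `(m log 2) ^ m`. -/
lemma factorial_mul_half_add_two_le (m : ℕ) (hm : 5 ≤ m) :
    (m ! : ℝ) * (((m : ℝ) + 2) / 2) ≤ (m * Real.log 2) ^ m := by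
  have hl : (0.6931 : ℝ) ≤ Real.log 2 := by linarith [Real.log_two_gt_d9]
  induction m, hm using Nat.le_induction with
  | base =>
    calc ((5 ! : ℕ) : ℝ) * (((5 : ℕ) + 2) / 2) ≤ ((5 : ℕ) * 0.6931) ^ 5 := by
          norm_num [Nat.factorial]
      _ ≤ _ := by gcongr
  | succ m hm ih =>
    have hm' : (5 : ℝ) ≤ m := by exact_mod_cast hm
    have hb : 2 * (m : ℝ) ^ m ≤ ((m : ℝ) + 1) ^ m := by
      have h := one_add_mul_le_pow (a := 1 / (m : ℝ)) (by
        have : 0 ≤ 1 / (m : ℝ) := by positivity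
        linarith) m
      have h2 : (1 + 1 / (m : ℝ)) ^ m * (m : ℝ) ^ m = ((m : ℝ) + 1) ^ m := by
        rw [← mul_pow]
        congr 1
        field_simp
      rw [mul_one_div_cancel (by positivity)] at h
      rw [← h2]
      gcongr
      linarith
    have hr : (m : ℝ) + 3 ≤ 2 * Real.log 2 * (m + 2) := by nlinarith
    push_cast [Nat.factorial_succ]
    calc ((m : ℝ) + 1) * m ! * ((m + 1 + 2) / 2)
        = (m + 1) * (m ! / 2) * (m + 3) := by ring
      _ ≤ (m + 1) * (m ! / 2) * (2 * Real.log 2 * (m + 2)) := by gcongr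
      _ = (m + 1) * (2 * Real.log 2) * (m ! * ((m + 2) / 2)) := by ring
      _ ≤ (m + 1) * (2 * Real.log 2) * (m * Real.log 2) ^ m := by gcongr
      _ = (m + 1) * Real.log 2 * Real.log 2 ^ m * (2 * m ^ m) := by rw [mul_pow]; ring
      _ ≤ (m + 1) * Real.log 2 * Real.log 2 ^ m * (m + 1) ^ m := by gcongr
      _ = ((m + 1) * Real.log 2) ^ (m + 1) := by rw [mul_pow, pow_succ, pow_succ]; ring

open Nat in
lemma factorial_mul_half_add_two_pow_le (m s : ℕ) (hs : 1 ≤ s) (hsm : s < m) :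
    ((m ! : ℝ) * (((m : ℝ) + 2) / 2)) ^ s ≤ ((s ! : ℝ) * 2 ^ m) ^ m := by
  rcases lt_or_ge m 5 with h | h
  · interval_cases m <;> interval_cases s <;> norm_num [Nat.factorial]
  · have hl : 0 ≤ Real.log 2 := Real.log_nonneg (by norm_num)
    have he : Real.exp (m * Real.log 2) = 2 ^ m := by
      rw [Real.exp_nat_mul, Real.exp_log (by norm_num)]
    have hp := Real.pow_div_factorial_le_exp (m * Real.log 2) (by positivity) s
    rw [he, div_le_iff₀ (by positivity)] at hp
    calc _ ≤ ((m * Real.log 2) ^ m) ^ s := by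
          gcongr
          exact factorial_mul_half_add_two_le m h
      _ = ((m * Real.log 2) ^ s) ^ m := pow_right_comm _ _ _
      _ ≤ _ := by
          rw [mul_comm (s ! : ℝ)]
          gcongr

lemma Nat.descFactorial_pow_le_descFactorial_pow (n q s : ℕ) :
    n.descFactorial (q + s) ^ q ≤ n.descFactorial q ^ (q + s) := by
  have h1 : n.descFactorial (q + s) ≤ n.descFactorial q * (n - q) ^ s := by
    rw [← Nat.descFactorial_mul_descFactorial (Nat.le_add_right q s), Nat.add_sub_cancel_left,
      mul_comm]
    gcongr
    exact Nat.descFactorial_le_pow _ _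
  have h2 : (n - q) ^ q ≤ n.descFactorial q :=
    (Nat.pow_le_pow_left (by omega) q).trans (Nat.pow_sub_le_descFactorial n q)
  calc _ ≤ (n.descFactorial q * (n - q) ^ s) ^ q := by gcongr
    _ = n.descFactorial q ^ q * ((n - q) ^ q) ^ s := by rw [mul_pow, pow_right_comm]
    _ ≤ n.descFactorial q ^ q * n.descFactorial q ^ s := by gcongr
    _ = _ := (pow_add _ _ _).symm

open Nat in
lemma choose_pow_mul_half_add_two_pow_le (n q s : ℕ) (hq : 1 ≤ q) (hs : 1 ≤ s) :
    ((q + s).choose q : ℝ) ^ (q + s) * ((((q + s : ℕ) : ℝ) + 2) / 2) ^ s *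
        (n.choose (q + s) : ℝ) ^ q ≤
      ((n.choose q : ℝ) * 2 ^ (q + s)) ^ (q + s) := by
  have h1 := factorial_mul_half_add_two_pow_le (q + s) s hs (by omega)
  have h2 : (((q + s)! : ℝ) * n.choose (q + s)) ^ q ≤ ((q ! : ℝ) * n.choose q) ^ (q + s) := by
    have h := Nat.descFactorial_pow_le_descFactorial_pow n q s
    rw [Nat.descFactorial_eq_factorial_mul_choose, Nat.descFactorial_eq_factorial_mul_choose] at h
    exact_mod_cast h
  have h3 : ((q + s).choose q : ℝ) * q ! * s ! = (q + s)! := by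
    rw [Nat.choose_symm_add]
    exact_mod_cast Nat.add_choose_mul_factorial_mul_factorial q s
  have hpos : (0 : ℝ) < ((q ! : ℝ) * s !) ^ (q + s) := by positivity
  refine le_of_mul_le_mul_right ?_ hpos
  calc _ = (((q + s).choose q : ℝ) * q ! * s !) ^ (q + s) *
          ((((q + s : ℕ) : ℝ) + 2) / 2) ^ s * (n.choose (q + s) : ℝ) ^ q := by
        simp only [mul_pow]; ring
    _ = (((q + s)! : ℝ) * ((((q + s : ℕ) : ℝ) + 2) / 2)) ^ s *
          (((q + s)! : ℝ) * n.choose (q + s)) ^ q := by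
        rw [h3]; simp only [mul_pow, pow_add]; ring
    _ ≤ ((s ! : ℝ) * 2 ^ (q + s)) ^ (q + s) * ((q ! : ℝ) * n.choose q) ^ (q + s) := by gcongr
    _ = _ := by simp only [← mul_pow]; ring

/-- Let `r ≥ k > p > 1` be integers.  Then
`C(k-1, p-1) · ((k+1)/2)^((k-p)/(k-1)) ≤ C(r-1, p-1) · C(r-1, k-1)^(−(p-1)/(k-1)) · 2^(k-1)`. -/
theorem stmt_12 (r k p : ℕ) (hp : 1 < p) (hpk : p < k) (hkr : k ≤ r) :
    (Nat.choose (k - 1) (p - 1) : ℝ) *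
        (((k : ℝ) + 1) / 2) ^ (((k : ℝ) - p) / ((k : ℝ) - 1)) ≤
      (Nat.choose (r - 1) (p - 1) : ℝ) *
        (Nat.choose (r - 1) (k - 1) : ℝ) ^ (-(((p : ℝ) - 1) / ((k : ℝ) - 1))) *
        2 ^ ((k : ℝ) - 1) := by
  obtain ⟨q, rfl⟩ : ∃ q, p = q + 1 := ⟨p - 1, by omega⟩
  obtain ⟨s, rfl⟩ : ∃ s, k = q + s + 1 := ⟨k - (q + 1), by omega⟩
  obtain ⟨n, rfl⟩ : ∃ n, r = n + 1 := ⟨r - 1, by omega⟩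
  have key := choose_pow_mul_half_add_two_pow_le n q s (by omega) (by omega)
  have hX : (0 : ℝ) < n.choose (q + s) := by
    exact_mod_cast Nat.choose_pos (by omega : q + s ≤ n)
  have hm : q + s ≠ 0 := by omega
  have hm' : ((q + s : ℕ) : ℝ) ≠ 0 := by exact_mod_cast hm
  have e1 : ((q + s + 1 : ℕ) : ℝ) - 1 = (q + s : ℕ) := by push_cast; ring
  have e2 : ((q + s + 1 : ℕ) : ℝ) - (q + 1 : ℕ) = s := by push_cast; ring
  have e3 : ((q + 1 : ℕ) : ℝ) - 1 = q := by push_cast; ring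
  have e4 : ((q + s + 1 : ℕ) : ℝ) + 1 = (q + s : ℕ) + 2 := by push_cast; ring
  rw [e1, e2, e3, e4]
  simp only [Nat.add_sub_cancel]
  have hpow : ∀ x : ℝ, 0 ≤ x → ∀ j : ℕ,
      (x ^ ((j : ℝ) / ((q + s : ℕ) : ℝ))) ^ (q + s) = x ^ j := fun x hx j => by
    rw [← Real.rpow_mul_natCast hx, div_mul_cancel₀ _ hm', Real.rpow_natCast]
  refine le_of_pow_le_pow_left₀ hm (by positivity) ?_
  rw [Real.rpow_neg hX.le, Real.rpow_natCast, mul_right_comm, mul_pow, mul_pow (_ * _), inv_pow,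
    hpow _ (by positivity), hpow _ hX.le, ← div_eq_mul_inv, le_div_iff₀ (by positivity)]
  exact key
end

section
/- Let r ≥ k > p > 1 be integers. Then for every natural number m, d_{p,r}^k(m) ≤ C(r-1, p-1) · C(r-1, k-1)^(−(p-1)/(k-1)) · 2^(k-1) · m^((p-1)/(k-1)). -/
/-- `tc n k r` : the number of cliques on `k` vertices in the Turán graph `T_{n,r}`
(the complete multipartite graph on `n` vertices whose `r` parts are as equal as possible).
This is the quantity `C(n,k)_r`. -/
noncomputable def tc (n k r : ℕ) : ℕ := ((SimpleGraph.turanGraph n r).cliqueSet k).ncard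

/-- `jkr r k m` : for `m > 0` (and `r ≥ k > 1`), the unique `n` with
`C(n, k-1)_{r-1} ≤ m < C(n+1, k-1)_{r-1}`. -/
noncomputable def jkr (r k m : ℕ) : ℕ :=
  Nat.findGreatest (fun n => tc n (k - 1) (r - 1) ≤ m) ((m + 2) * r)

/-- The function `d_{p,r}^k`, defined recursively by `d_{p,r}^k(0) = 0` and
`d_{p,r}^k(m) = C(j_k^r(m), p-1)_{r-1} + d_{p,r}^k(m - C(j_k^r(m), k-1)_{r-1})` for `m > 0`.
(In the regime of interest, `r ≥ k > p ≥ 1`, one always has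
`tc (jkr r k m) (k-1) (r-1) ≥ 1`, so the `max 1` below is the identity and this definition
agrees with the stated recursion; the `max 1` merely guarantees termination in degenerate
cases such as `r < k`.) -/
noncomputable def dprk (p r k : ℕ) : ℕ → ℕ
  | 0 => 0
  | m + 1 =>
    tc (jkr r k (m + 1)) (p - 1) (r - 1) +
      dprk p r k (m + 1 - max 1 (tc (jkr r k (m + 1)) (k - 1) (r - 1)))
decreasing_by
  have := Nat.le_max_left 1 (tc (jkr r k (m + 1)) (k - 1) (r - 1))
  omega

/-- The `j`-th elementary symmetric polynomial of the values `c i`, `i ∈ S`. -/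
def esymmOn (c : ℕ → ℕ) (S : Finset ℕ) (j : ℕ) : ℕ :=
  ∑ P ∈ S.powersetCard j, ∏ i ∈ P, c i

lemma esymmOn_zero (c : ℕ → ℕ) (S : Finset ℕ) : esymmOn c S 0 = 1 := by
  simp [esymmOn]

lemma esymmOn_insert (c : ℕ → ℕ) {S : Finset ℕ} {i : ℕ} (hi : i ∉ S) (j : ℕ) :
    esymmOn c (insert i S) (j + 1) = esymmOn c S (j + 1) + c i * esymmOn c S j := by
  unfold esymmOn
  rw [Finset.powersetCard_succ_insert hi, Finset.sum_union, Finset.sum_image, Finset.mul_sum]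
  · congr 1
    refine Finset.sum_congr rfl fun P hP => ?_
    rw [Finset.prod_insert fun h => hi ((Finset.mem_powersetCard.1 hP).1 h)]
  · intro P hP Q hQ h
    have hP' : i ∉ P := fun h => hi ((Finset.mem_powersetCard.1 hP).1 h)
    have hQ' : i ∉ Q := fun h => hi ((Finset.mem_powersetCard.1 hQ).1 h)
    rw [← Finset.erase_insert hP', ← Finset.erase_insert hQ', h]
  · rw [Finset.disjoint_left]
    intro P hP hP'
    obtain ⟨Q, -, rfl⟩ := Finset.mem_image.1 hP'
    exact hi ((Finset.mem_powersetCard.1 hP).1 (Finset.mem_insert_self _ _))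

lemma esymmOn_eq_erase (c : ℕ → ℕ) {S : Finset ℕ} {i : ℕ} (hi : i ∈ S) (j : ℕ) :
    esymmOn c S (j + 1) = esymmOn c (S.erase i) (j + 1) + c i * esymmOn c (S.erase i) j := by
  rw [← esymmOn_insert c (Finset.notMem_erase i S), Finset.insert_erase hi]

lemma esymmOn_congr {c c' : ℕ → ℕ} {S : Finset ℕ} (h : ∀ i ∈ S, c i = c' i) (j : ℕ) :
    esymmOn c S j = esymmOn c' S j :=
  Finset.sum_congr rfl fun _ hP => Finset.prod_congr rfl fun i hi =>
    h i ((Finset.mem_powersetCard.1 hP).1 hi)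

lemma sum_mul_esymmOn_erase (c : ℕ → ℕ) (S : Finset ℕ) (j : ℕ) :
    ∑ i ∈ S, c i * esymmOn c (S.erase i) j = (j + 1) * esymmOn c S (j + 1) := by
  induction S using Finset.induction_on generalizing j with
  | empty => simp [esymmOn]
  | insert x S hx ih =>
    rw [Finset.sum_insert hx, Finset.erase_insert hx, esymmOn_insert c hx]
    have key : ∀ i ∈ S, (insert x S).erase i = insert x (S.erase i) := fun i hi =>
      Finset.erase_insert_of_ne fun h => hx (h ▸ hi)
    rw [Finset.sum_congr rfl fun i hi => by rw [key i hi]]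
    cases j with
    | zero =>
      have := ih 0
      simp only [esymmOn_zero] at this ⊢
      rw [this]
      ring
    | succ j =>
      have : ∀ i ∈ S, c i * esymmOn c (insert x (S.erase i)) (j + 1) =
          c i * esymmOn c (S.erase i) (j + 1) + c x * (c i * esymmOn c (S.erase i) j) := by
        intro i _
        rw [esymmOn_insert c (fun h => hx (Finset.mem_of_mem_erase h))]
        ring
      rw [Finset.sum_congr rfl this, Finset.sum_add_distrib, ← Finset.mul_sum, ih, ih]
      ring

lemma sum_powersetCard_erase_comm (S : Finset ℕ) (j : ℕ) (F : ℕ → Finset ℕ → ℕ) :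
    ∑ i ∈ S, ∑ P ∈ (S.erase i).powersetCard j, F i P =
      ∑ P ∈ S.powersetCard j, ∑ i ∈ S \ P, F i P := by
  refine Finset.sum_comm' fun i P => ?_
  simp only [Finset.mem_powersetCard, Finset.mem_sdiff, Finset.subset_erase]
  tauto

lemma succ_mul_esymmOn_succ (c : ℕ → ℕ) (S : Finset ℕ) (j : ℕ) :
    (j + 1) * esymmOn c S (j + 1) =
      ∑ P ∈ S.powersetCard j, (∑ i ∈ S \ P, c i) * ∏ i ∈ P, c i := by
  rw [← sum_mul_esymmOn_erase]
  simp only [esymmOn, Finset.mul_sum, Finset.sum_mul]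
  exact sum_powersetCard_erase_comm S j fun i P => c i * ∏ l ∈ P, c l

lemma sum_esymmOn_erase (c : ℕ → ℕ) (S : Finset ℕ) (j : ℕ) :
    ∑ i ∈ S, esymmOn c (S.erase i) j = (S.card - j) * esymmOn c S j := by
  simp only [esymmOn, Finset.mul_sum]
  rw [sum_powersetCard_erase_comm S j fun _ P => ∏ l ∈ P, c l]
  refine Finset.sum_congr rfl fun P hP => ?_
  obtain ⟨h1, h2⟩ := Finset.mem_powersetCard.1 hP
  rw [Finset.sum_const, Finset.card_sdiff_of_subset h1, h2, smul_eq_mul]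

/-- A pointwise lower bound for the complementary sums bounds the ratio of consecutive
elementary symmetric polynomials. -/
lemma mul_esymmOn_le (c : ℕ → ℕ) (S : Finset ℕ) (j x y : ℕ)
    (h : ∀ P ∈ S.powersetCard j, x ≤ y * ∑ i ∈ S \ P, c i) :
    x * esymmOn c S j ≤ y * ((j + 1) * esymmOn c S (j + 1)) := by
  rw [succ_mul_esymmOn_succ, esymmOn, Finset.mul_sum, Finset.mul_sum]
  refine Finset.sum_le_sum fun P hP => ?_
  rw [← mul_assoc]
  exact Nat.mul_le_mul_right _ (h P hP)

lemma esymmOn_erase_antitone (c : ℕ → ℕ) {S : Finset ℕ} {i l : ℕ} (hi : i ∈ S) (hl : l ∈ S)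
    (h : c i ≤ c l) (j : ℕ) : esymmOn c (S.erase l) j ≤ esymmOn c (S.erase i) j := by
  rcases eq_or_ne i l with rfl | hne
  · rfl
  cases j with
  | zero => simp [esymmOn_zero]
  | succ j =>
    rw [esymmOn_eq_erase c (Finset.mem_erase.2 ⟨hne, hi⟩),
      esymmOn_eq_erase c (Finset.mem_erase.2 ⟨hne.symm, hl⟩), Finset.erase_right_comm]
    gcongr

/-- Chebyshev's sum inequality gives the first step of Maclaurin's inequality. -/
lemma card_mul_succ_mul_esymmOn_succ_le (c : ℕ → ℕ) (S : Finset ℕ) (j : ℕ) :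
    S.card * ((j + 1) * esymmOn c S (j + 1)) ≤
      (∑ i ∈ S, c i) * ((S.card - j) * esymmOn c S j) := by
  rw [← sum_mul_esymmOn_erase, ← sum_esymmOn_erase]
  refine AntivaryOn.card_mul_sum_le_sum_mul_sum fun i hi l hl h => ?_
  by_contra! hlt
  exact absurd (esymmOn_erase_antitone c hi hl hlt.le j) (not_le.2 h)

lemma esymmOn_mul_card_pow_le (c : ℕ → ℕ) (S : Finset ℕ) (j : ℕ) :
    esymmOn c S j * S.card ^ j ≤ S.card.choose j * (∑ i ∈ S, c i) ^ j := by
  induction j with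
  | zero => simp [esymmOn_zero]
  | succ j ih =>
    have h := card_mul_succ_mul_esymmOn_succ_le c S j
    have hc := Nat.choose_succ_right_eq S.card j
    refine Nat.le_of_mul_le_mul_left ?_ (show 0 < j + 1 by omega)
    calc (j + 1) * (esymmOn c S (j + 1) * S.card ^ (j + 1))
        = (S.card * ((j + 1) * esymmOn c S (j + 1))) * S.card ^ j := by ring
      _ ≤ ((∑ i ∈ S, c i) * ((S.card - j) * esymmOn c S j)) * S.card ^ j := by gcongr
      _ = ((∑ i ∈ S, c i) * (S.card - j)) * (esymmOn c S j * S.card ^ j) := by ring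
      _ ≤ ((∑ i ∈ S, c i) * (S.card - j)) * (S.card.choose j * (∑ i ∈ S, c i) ^ j) := by gcongr
      _ = (S.card.choose j * (S.card - j)) * (∑ i ∈ S, c i) ^ (j + 1) := by ring
      _ = _ := by rw [← hc]; ring

lemma sub_mul_sub_le_card_mul_sum_sdiff (c : ℕ → ℕ) {S P : Finset ℕ} (hP : P ⊆ S)
    (hc : ∀ i ∈ S, ∀ l ∈ S, c i ≤ c l + 1) :
    (S.card - P.card) * (∑ i ∈ S, c i - P.card) ≤ S.card * ∑ i ∈ S \ P, c i := by
  have h1 : (S \ P).card * ∑ i ∈ P, c i ≤ P.card * (∑ i ∈ S \ P, c i + (S \ P).card) := by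
    have : ∑ i ∈ P, ∑ _l ∈ S \ P, c i ≤ ∑ _i ∈ P, ∑ l ∈ S \ P, (c l + 1) :=
      Finset.sum_le_sum fun i hi => Finset.sum_le_sum fun l hl =>
        hc i (hP hi) l (Finset.mem_sdiff.1 hl).1
    simpa [← Finset.mul_sum, Finset.sum_add_distrib] using this
  have h2 := Finset.sum_sdiff (f := c) hP
  have h3 := Finset.card_sdiff_add_card_eq_card hP
  rw [← h2, ← h3, Nat.add_sub_cancel]
  set w := ∑ i ∈ S \ P, c i
  set v := ∑ i ∈ P, c i
  rcases le_total P.card (w + v) with h | h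
  · zify [h] at h1 ⊢
    nlinarith
  · simp [Nat.sub_eq_zero_of_le h]

lemma sub_le_sum_sdiff (c : ℕ → ℕ) {S P : Finset ℕ} (hP : P ⊆ S) (hc : ∀ i ∈ P, c i ≤ 1) :
    ∑ i ∈ S, c i - P.card ≤ ∑ i ∈ S \ P, c i := by
  have h2 := Finset.sum_sdiff (f := c) hP
  have h3 : ∑ i ∈ P, c i ≤ P.card := by simpa using Finset.sum_le_card_nsmul P c 1 hc
  omega

lemma min_sub_le_sum_sdiff (c : ℕ → ℕ) {S P : Finset ℕ} (hP : P ⊆ S)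
    (hc : ∀ i ∈ S, ∀ l ∈ S, c i ≤ c l + 1) :
    min S.card (∑ i ∈ S, c i) - P.card ≤ ∑ i ∈ S \ P, c i := by
  by_cases h : ∃ l ∈ S, c l = 0
  · obtain ⟨l, hl, h0⟩ := h
    have := sub_le_sum_sdiff c hP fun i hi => by simpa [h0] using hc i (hP hi) l hl
    omega
  · push Not at h
    have h3 : (S \ P).card ≤ ∑ i ∈ S \ P, c i := by
      simpa using Finset.card_nsmul_le_sum (S \ P) c 1 fun i hi =>
        Nat.one_le_iff_ne_zero.2 (h i (Finset.mem_sdiff.1 hi).1)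
    have := Finset.card_sdiff_add_card_eq_card hP
    omega

/-- Maclaurin-type reverse inequality for balanced values. -/
lemma esymmOn_mul_descFactorial_le (c : ℕ → ℕ) (S : Finset ℕ)
    (hc : ∀ i ∈ S, ∀ l ∈ S, c i ≤ c l + 1) (b d : ℕ) :
    esymmOn c S b * S.card.choose (b + d) * (∑ i ∈ S, c i - b).descFactorial d ≤
      S.card.choose b * S.card ^ d * esymmOn c S (b + d) := by
  induction d with
  | zero => simp [mul_comm]
  | succ d ih =>
    have h := mul_esymmOn_le c S (b + d) ((S.card - (b + d)) * (∑ i ∈ S, c i - (b + d))) S.card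
      fun P hP => by
        obtain ⟨h1, h2⟩ := Finset.mem_powersetCard.1 hP
        simpa [h2] using sub_mul_sub_le_card_mul_sum_sdiff c h1 hc
    have hch := Nat.choose_succ_right_eq S.card (b + d)
    refine Nat.le_of_mul_le_mul_left ?_ (show 0 < b + d + 1 by omega)
    rw [Nat.descFactorial_succ, Nat.sub_sub, ← add_assoc]
    set n := ∑ i ∈ S, c i
    calc (b + d + 1) * (esymmOn c S b * S.card.choose (b + d + 1) *
          ((n - (b + d)) * (n - b).descFactorial d))
        = (S.card.choose (b + d + 1) * (b + d + 1)) * (n - (b + d)) *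
          (esymmOn c S b * (n - b).descFactorial d) := by ring
      _ = ((S.card - (b + d)) * (n - (b + d))) *
          (esymmOn c S b * S.card.choose (b + d) * (n - b).descFactorial d) := by rw [hch]; ring
      _ ≤ ((S.card - (b + d)) * (n - (b + d))) *
          (S.card.choose b * S.card ^ d * esymmOn c S (b + d)) := by gcongr
      _ = (S.card.choose b * S.card ^ d) *
          ((S.card - (b + d)) * (n - (b + d)) * esymmOn c S (b + d)) := by ring
      _ ≤ (S.card.choose b * S.card ^ d) *
          (S.card * ((b + d + 1) * esymmOn c S (b + d + 1))) := by gcongr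
      _ = _ := by ring

lemma esymmOn_mul_choose_le (c : ℕ → ℕ) (S : Finset ℕ)
    (hc : ∀ i ∈ S, ∀ l ∈ S, c i ≤ c l + 1) {a : ℕ} (ha : a ≤ min S.card (∑ i ∈ S, c i))
    (b d : ℕ) :
    esymmOn c S b * a.choose (b + d) ≤ a.choose b * esymmOn c S (b + d) := by
  induction d with
  | zero => simp [mul_comm]
  | succ d ih =>
    have h := mul_esymmOn_le c S (b + d) (a - (b + d)) 1
      fun P hP => by
        obtain ⟨h1, h2⟩ := Finset.mem_powersetCard.1 hP
        have := min_sub_le_sum_sdiff c h1 hc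
        omega
    have hch := Nat.choose_succ_right_eq a (b + d)
    refine Nat.le_of_mul_le_mul_left ?_ (show 0 < b + d + 1 by omega)
    rw [← add_assoc]
    calc (b + d + 1) * (esymmOn c S b * a.choose (b + d + 1))
        = esymmOn c S b * (a.choose (b + d + 1) * (b + d + 1)) := by ring
      _ = (a - (b + d)) * (esymmOn c S b * a.choose (b + d)) := by rw [hch]; ring
      _ ≤ (a - (b + d)) * (a.choose b * esymmOn c S (b + d)) := by gcongr
      _ = a.choose b * ((a - (b + d)) * esymmOn c S (b + d)) := by ring
      _ ≤ a.choose b * (1 * ((b + d + 1) * esymmOn c S (b + d + 1))) := by gcongr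
      _ = _ := by ring

/-- The size of the part of colour `i` in the Turán graph on `n` vertices with `s` parts. -/
def partSize (s n i : ℕ) : ℕ := ((Finset.range n).filter fun v => v % s = i).card

lemma partSize_succ (s n i : ℕ) :
    partSize s (n + 1) i = partSize s n i + if n % s = i then 1 else 0 := by
  unfold partSize
  rw [Finset.range_add_one, Finset.filter_insert]
  split_ifs
  · rw [Finset.card_insert_of_notMem (by simp)]
  · rfl

lemma sum_partSize {s : ℕ} (hs : 0 < s) (n : ℕ) : ∑ i ∈ Finset.range s, partSize s n i = n := by
  have h := Finset.card_eq_sum_card_fiberwise (s := Finset.range n) (t := Finset.range s)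
    (f := fun v => v % s) fun v _ => by simpa using Nat.mod_lt v hs
  simpa [partSize] using h.symm

lemma partSize_eq_count (s n i : ℕ) (hi : i < s) : partSize s n i = n.count (· ≡ i [MOD s]) := by
  rw [Nat.count_eq_card_filter_range, partSize]
  congr 1
  ext v
  simp [Nat.ModEq, Nat.mod_eq_of_lt hi]

lemma partSize_le_partSize_add_one {s n i l : ℕ} (hi : i < s) (hl : l < s) :
    partSize s n i ≤ partSize s n l + 1 := by
  have hs : 0 < s := by omega
  rw [partSize_eq_count s n i hi, partSize_eq_count s n l hl, Nat.count_modEq_card _ hs,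
    Nat.count_modEq_card _ hs]
  split_ifs <;> omega

open Classical in
/-- The number of `j`-subsets of `V` whose elements have distinct colours. -/
lemma card_filter_injOn_eq_esymmOn (V S : Finset ℕ) (f : ℕ → ℕ) (hf : ∀ v ∈ V, f v ∈ S)
    (j : ℕ) :
    ((V.powersetCard j).filter fun Q : Finset ℕ => Set.InjOn f Q).card =
      esymmOn (fun i => (V.filter fun v => f v = i).card) S j := by
  classical
  rw [Finset.card_eq_sum_card_fiberwise (t := S.powersetCard j) (f := fun Q => Q.image f)]
  swap
  · intro Q hQ
    rw [Finset.mem_coe, Finset.mem_filter, Finset.mem_powersetCard] at hQ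
    rw [Finset.mem_coe, Finset.mem_powersetCard]
    obtain ⟨⟨h1, h2⟩, h3⟩ := hQ
    refine ⟨fun i hi => ?_, ?_⟩
    · obtain ⟨v, hv, rfl⟩ := Finset.mem_image.1 hi
      exact hf v (h1 hv)
    · rw [Finset.card_image_of_injOn h3, h2]
  refine Finset.sum_congr rfl fun P hP => ?_
  obtain ⟨hPS, hPj⟩ := Finset.mem_powersetCard.1 hP
  rw [← Finset.card_pi]
  symm
  refine Finset.card_bij (fun g _ => P.attach.image fun i => g i.1 i.2) ?_ ?_ ?_
  · intro g hg
    simp only [Finset.mem_pi, Finset.mem_filter] at hg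
    have himg : (P.attach.image fun i => g i.1 i.2).image f = P := by
      ext i
      simp only [Finset.mem_image, Finset.mem_attach, true_and, Subtype.exists]
      constructor
      · rintro ⟨v, ⟨l, hl, rfl⟩, rfl⟩
        rw [(hg l hl).2]
        exact hl
      · exact fun hi => ⟨_, ⟨i, hi, rfl⟩, (hg i hi).2⟩
    have hinj : Set.InjOn f ((P.attach.image fun i => g i.1 i.2 : Finset ℕ) : Set ℕ) := by
      intro v hv w hw h
      simp only [Finset.coe_image, Set.mem_image, Finset.mem_coe, Finset.mem_attach, true_and,
        Subtype.exists] at hv hw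
      obtain ⟨l, hl, rfl⟩ := hv
      obtain ⟨l', hl', rfl⟩ := hw
      rw [(hg l hl).2, (hg l' hl').2] at h
      subst h
      rfl
    simp only [Finset.mem_filter, Finset.mem_powersetCard]
    refine ⟨⟨⟨?_, ?_⟩, hinj⟩, himg⟩
    · intro v hv
      simp only [Finset.mem_image, Finset.mem_attach, true_and, Subtype.exists] at hv
      obtain ⟨l, hl, rfl⟩ := hv
      exact (hg l hl).1
    · rw [← Finset.card_image_of_injOn hinj, himg, hPj]
  · intro g hg g' hg' h
    simp only [Finset.mem_pi, Finset.mem_filter] at hg hg'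
    funext i hi
    have : g i hi ∈ P.attach.image fun i => g' i.1 i.2 := by
      rw [← h]
      exact Finset.mem_image.2 ⟨⟨i, hi⟩, Finset.mem_attach _ _, rfl⟩
    simp only [Finset.mem_image, Finset.mem_attach, true_and, Subtype.exists] at this
    obtain ⟨l, hl, h⟩ := this
    have : l = i := by rw [← (hg' l hl).2, h, (hg i hi).2]
    subst this
    exact h.symm
  · intro Q hQ
    simp only [Finset.mem_filter, Finset.mem_powersetCard] at hQ
    obtain ⟨⟨⟨hQV, hQj⟩, hinj⟩, rfl⟩ := hQ
    choose g hg hgf using fun (i : ℕ) (hi : i ∈ Q.image f) => Finset.mem_image.1 hi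
    refine ⟨g, ?_, ?_⟩
    · simp only [Finset.mem_pi, Finset.mem_filter]
      exact fun i hi => ⟨hQV (hg i hi), hgf i hi⟩
    · ext v
      simp only [Finset.mem_image, Finset.mem_attach, true_and, Subtype.exists]
      constructor
      · rintro ⟨i, hi, rfl⟩
        exact hg i (Finset.mem_image.2 hi)
      · intro hv
        refine ⟨f v, ⟨v, hv, rfl⟩, hinj (hg _ _) hv (hgf _ _)⟩

lemma tc_eq_esymmOn {s : ℕ} (hs : 0 < s) (n j : ℕ) :
    tc n j s = esymmOn (partSize s n) (Finset.range s) j := by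
  classical
  have h := card_filter_injOn_eq_esymmOn (Finset.range n) (Finset.range s) (· % s)
    (fun v _ => by simpa using Nat.mod_lt v hs) j
  have hps : partSize s n = fun i => ((Finset.range n).filter fun v => v % s = i).card := rfl
  rw [hps, ← h, tc, ← Set.ncard_coe_finset]
  refine Set.ncard_congr (fun Q _ => Q.map Fin.valEmbedding) ?_ ?_ ?_
  · intro Q hQ
    rw [SimpleGraph.mem_cliqueSet_iff, SimpleGraph.isNClique_iff] at hQ
    simp only [Finset.coe_filter, Finset.mem_powersetCard, Set.mem_ofPred_eq, Finset.card_map]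
    refine ⟨⟨fun v hv => ?_, hQ.2⟩, ?_⟩
    · obtain ⟨w, -, rfl⟩ := Finset.mem_map.1 hv
      simp
    · intro v hv w hw hvw
      simp only [Finset.coe_map, Set.mem_image, Finset.mem_coe] at hv hw
      obtain ⟨v, hv, rfl⟩ := hv
      obtain ⟨w, hw, rfl⟩ := hw
      by_contra hne
      exact hQ.1 hv hw (fun h => hne (by rw [h])) hvw
  · intro Q Q' _ _ h
    exact Finset.map_injective _ h
  · intro Q hQ
    simp only [Finset.coe_filter, Finset.mem_powersetCard, Set.mem_ofPred_eq] at hQ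
    obtain ⟨⟨h1, h2⟩, h3⟩ := hQ
    have h1' : ∀ v ∈ Q, v < n := fun v hv => Finset.mem_range.1 (h1 hv)
    refine ⟨Q.attachFin h1', ?_, by simp [Finset.map_valEmbedding_attachFin]⟩
    rw [SimpleGraph.mem_cliqueSet_iff, SimpleGraph.isNClique_iff, Finset.card_attachFin]
    refine ⟨fun v hv w hw hne h => hne (Fin.ext (h3 ?_ ?_ h)), h2⟩
    · simpa using hv
    · simpa using hw

lemma tc_eq_choose {n s : ℕ} (h : n ≤ s) (j : ℕ) : tc n j s = n.choose j := by
  classical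
  rw [tc, SimpleGraph.turanGraph_eq_top.2 (Or.inr h)]
  have : (⊤ : SimpleGraph (Fin n)).cliqueSet j =
      ((Finset.univ.powersetCard j : Finset (Finset (Fin n))) : Set (Finset (Fin n))) := by
    ext Q
    simp [SimpleGraph.mem_cliqueSet_iff, SimpleGraph.isNClique_iff]
  rw [this, Set.ncard_coe_finset, Finset.card_powersetCard, Finset.card_univ, Fintype.card_fin]

lemma tc_mul_pow_le {s : ℕ} (hs : 0 < s) (n j : ℕ) : tc n j s * s ^ j ≤ s.choose j * n ^ j := by
  simpa [tc_eq_esymmOn hs, sum_partSize hs] using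
    esymmOn_mul_card_pow_le (partSize s n) (Finset.range s) j

lemma tc_mul_descFactorial_le {s : ℕ} (hs : 0 < s) (n b d : ℕ) :
    tc n b s * s.choose (b + d) * (n - b).descFactorial d ≤
      s.choose b * s ^ d * tc n (b + d) s := by
  simpa [tc_eq_esymmOn hs, sum_partSize hs] using
    esymmOn_mul_descFactorial_le (partSize s n) (Finset.range s)
      (fun i hi l hl => partSize_le_partSize_add_one (Finset.mem_range.1 hi)
        (Finset.mem_range.1 hl)) b d

lemma tc_le_choose_mul {s n b a : ℕ} (hs : 0 < s) (hba : b ≤ a) (has : a ≤ s) (han : a ≤ n) :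
    tc n b s ≤ a.choose b * tc n a s := by
  have := esymmOn_mul_choose_le (partSize s n) (Finset.range s)
      (fun i hi l hl => partSize_le_partSize_add_one (Finset.mem_range.1 hi)
        (Finset.mem_range.1 hl)) (a := a) (by simp [sum_partSize hs, has, han]) b (a - b)
  simpa [tc_eq_esymmOn hs, Nat.add_sub_cancel' hba] using this

lemma tc_pos {s n a : ℕ} (hs : 0 < s) (has : a ≤ s) (han : a ≤ n) : 0 < tc n a s := by
  have h := tc_le_choose_mul hs (Nat.zero_le a) has han
  rw [tc_eq_esymmOn hs n 0, esymmOn_zero] at h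
  exact Nat.pos_of_mul_pos_left (lt_of_lt_of_le one_pos h)

lemma tc_succ {s : ℕ} (hs : 0 < s) (n j : ℕ) :
    tc (n + 1) (j + 1) s =
      tc n (j + 1) s + esymmOn (partSize s n) ((Finset.range s).erase (n % s)) j := by
  have hmem : n % s ∈ Finset.range s := Finset.mem_range.2 (Nat.mod_lt n hs)
  have hcongr : ∀ i ∈ (Finset.range s).erase (n % s), partSize s (n + 1) i = partSize s n i := by
    intro i hi
    rw [partSize_succ, if_neg (Finset.ne_of_mem_erase hi).symm, add_zero]
  rw [tc_eq_esymmOn hs, tc_eq_esymmOn hs, esymmOn_eq_erase _ hmem,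
    esymmOn_eq_erase (partSize s n) hmem, esymmOn_congr hcongr, esymmOn_congr hcongr,
    partSize_succ, if_pos rfl]
  ring

/-- One more vertex increases the number of `a`-cliques by a bounded factor. -/
lemma tc_succ_left_le {s n j : ℕ} (hs : 0 < s) (d e : ℕ)
    (hd : d ≤ e) (hde : d * (j + 1) ≤ e * (n - j)) :
    d * tc (n + 1) (j + 1) s ≤ (d + e) * tc n (j + 1) s := by
  have hmem : n % s ∈ Finset.range s := Finset.mem_range.2 (Nat.mod_lt n hs)
  set S := (Finset.range s).erase (n % s) with hS
  suffices h : d * esymmOn (partSize s n) S j ≤ e * tc n (j + 1) s by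
    rw [tc_succ hs]
    linarith
  rcases Nat.eq_zero_or_pos (partSize s n (n % s)) with h0 | h0
  · have hone : ∀ i < s, partSize s n i ≤ 1 := fun i hi => by
      simpa [h0] using partSize_le_partSize_add_one (n := n) hi (Nat.mod_lt n hs)
    have hsum : ∑ i ∈ S, partSize s n i = n := by
      have := sum_partSize hs n
      rw [← Finset.add_sum_erase _ _ hmem, h0] at this
      simpa using this
    have h := mul_esymmOn_le (partSize s n) S j (n - j) 1 fun P hP => by
      obtain ⟨h1, h2⟩ := Finset.mem_powersetCard.1 hP
      have := sub_le_sum_sdiff (partSize s n) h1 fun i hi =>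
        hone i (Finset.mem_range.1 (Finset.mem_of_mem_erase (h1 hi)))
      rw [hsum, h2] at this
      simpa using this
    rw [tc_eq_esymmOn hs, esymmOn_eq_erase _ hmem, h0, zero_mul, add_zero, ← hS]
    refine Nat.le_of_mul_le_mul_left ?_ (show 0 < j + 1 by omega)
    calc (j + 1) * (d * esymmOn (partSize s n) S j)
        = (d * (j + 1)) * esymmOn (partSize s n) S j := by ring
      _ ≤ (e * (n - j)) * esymmOn (partSize s n) S j := by gcongr
      _ = e * ((n - j) * esymmOn (partSize s n) S j) := by ring
      _ ≤ e * (1 * ((j + 1) * esymmOn (partSize s n) S (j + 1))) := by gcongr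
      _ = (j + 1) * (e * esymmOn (partSize s n) S (j + 1)) := by ring
  · rw [tc_eq_esymmOn hs, esymmOn_eq_erase _ hmem, ← hS]
    refine Nat.mul_le_mul hd ?_
    nlinarith [Nat.zero_le (esymmOn (partSize s n) S (j + 1)),
      Nat.mul_le_mul_right (esymmOn (partSize s n) S j) h0]

lemma lt_tc_of_mul_le {s n a m : ℕ} (hs : 0 < s) (ha : 0 < a) (has : a ≤ s)
    (hn : (m + 2) * s ≤ n) : m < tc n a s := by
  have hpart : ∀ i ∈ Finset.range s, m + 1 ≤ partSize s n i := by
    intro i hi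
    by_contra! hlt
    have hlt' : ∑ l ∈ Finset.range s, partSize s n l < ∑ _l ∈ Finset.range s, (m + 2) := by
      refine Finset.sum_lt_sum (fun l hl => ?_) ⟨i, hi, by omega⟩
      have := partSize_le_partSize_add_one (n := n) (Finset.mem_range.1 hl) (Finset.mem_range.1 hi)
      omega
    rw [sum_partSize hs, Finset.sum_const, Finset.card_range, smul_eq_mul] at hlt'
    nlinarith
  rw [tc_eq_esymmOn hs]
  have hmem : Finset.range a ∈ (Finset.range s).powersetCard a := by simp [has]
  have h1 : ∏ i ∈ Finset.range a, partSize s n i ≤ esymmOn (partSize s n) (Finset.range s) a :=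
    Finset.single_le_sum (f := fun P : Finset ℕ => ∏ i ∈ P, partSize s n i)
      (fun _ _ => Nat.zero_le _) hmem
  have h2 : (m + 1) ^ a ≤ ∏ i ∈ Finset.range a, partSize s n i := by
    simpa using Finset.pow_card_le_prod (s := Finset.range a) (f := partSize s n) (n := m + 1)
      fun i hi => hpart i (Finset.mem_range.2 ((Finset.mem_range.1 hi).trans_le has))
  have h3 : m + 1 ≤ (m + 1) ^ a := Nat.le_self_pow ha.ne' _
  omega

lemma factorial_bounds_of_lt_thirty : ∀ a < 30, ∀ b < a, 0 < b →
    a ^ ((a - b) * b) * (a + 1) ^ (a - b) ≤ 2 ^ (a * a) * (a - b).factorial ^ b ∧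
    (a + 1) ^ ((a - b) * b) * (a + 2) ^ (a - b) * a ^ a ≤
      2 ^ (a * a + (a - b)) * b ^ a * (a - b + 1).factorial ^ b := by
  decide +kernel

lemma log_pow_le_log_factorial_add {x : ℕ} (hx : 0 < x) (k : ℕ) :
    k * Real.log x ≤ Real.log k.factorial + k * Real.log 2 + x / 2 := by
  have h := Real.pow_div_factorial_le_exp (x / 2 : ℝ) (by positivity) k
  have hx' : (0 : ℝ) < x := by exact_mod_cast hx
  have hk : (0 : ℝ) < k.factorial := by exact_mod_cast k.factorial_pos
  have h2 := Real.log_le_log (by positivity) h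
  rw [Real.log_exp, Real.log_div (by positivity) hk.ne', Real.log_pow,
    Real.log_div hx'.ne' two_ne_zero] at h2
  linarith

lemma log_add_two_le {a : ℝ} (ha : 30 ≤ a) : Real.log (a + 2) ≤ 0.1156 * a := by
  have h1 : Real.log (a + 2) = Real.log 32 + Real.log ((a + 2) / 32) := by
    rw [← Real.log_mul (by norm_num) (by positivity)]
    congr 1
    ring
  have h2 : Real.log 32 = 5 * Real.log 2 := by
    rw [show (32 : ℝ) = 2 ^ 5 by norm_num, Real.log_pow]
    norm_num
  have h3 := Real.log_le_sub_one_of_pos (show 0 < (a + 2) / 32 by positivity)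
  have := Real.log_two_lt_d9
  linarith

lemma pow_mul_pow_le_factorial_pow {a b : ℕ} (hb : 0 < b) (hba : b < a) :
    a ^ ((a - b) * b) * (a + 1) ^ (a - b) ≤ 2 ^ (a * a) * (a - b).factorial ^ b := by
  rcases lt_or_ge a 30 with ha | ha
  · exact (factorial_bounds_of_lt_thirty a ha b hba hb).1
  obtain ⟨c, rfl⟩ := Nat.exists_eq_add_of_lt hba
  rw [show b + c + 1 - b = c + 1 by omega]
  set a := b + c + 1 with hadef
  have hf : (0 : ℝ) < (c + 1).factorial := by exact_mod_cast (c + 1).factorial_pos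
  have ha0 : (0 : ℝ) < a := by positivity
  suffices h : ((a : ℝ) ^ ((c + 1) * b) * (a + 1) ^ (c + 1)) ≤
      2 ^ (a * a) * ((c + 1).factorial : ℝ) ^ b by exact_mod_cast h
  rw [← Real.log_le_log_iff (by positivity) (by positivity),
    Real.log_mul (by positivity) (by positivity), Real.log_mul (by positivity) (by positivity),
    Real.log_pow, Real.log_pow, Real.log_pow, Real.log_pow]
  have h1 := log_pow_le_log_factorial_add (x := a) (by omega) (c + 1)
  have ha' : (30 : ℝ) ≤ a := by exact_mod_cast ha
  have h2 := log_add_two_le ha'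
  have h3 : Real.log (a + 1) ≤ Real.log (a + 2) :=
    Real.log_le_log (by positivity) (by linarith)
  have hl := Real.log_two_gt_d9
  have hc : ((c + 1 : ℕ) : ℝ) = a - b := by rw [hadef]; push_cast; ring
  have hb' : (0 : ℝ) ≤ b := by positivity
  have hab : (b : ℝ) ≤ a := by exact_mod_cast hba.le
  have h4 := mul_le_mul_of_nonneg_left h1 hb'
  have h5 := mul_le_mul_of_nonneg_left (h3.trans h2) (sub_nonneg.2 hab)
  push_cast [hc] at h4 ⊢
  have h6 : 0 ≤ (Real.log 2 - 0.693) * (a * a - b * (a - b)) :=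
    mul_nonneg (by linarith) (by nlinarith)
  nlinarith [sq_nonneg (a - 1.3 * b : ℝ), mul_nonneg hb' (sub_nonneg.2 hab)]

lemma succ_pow_mul_pow_le_factorial_pow {a b : ℕ} (hb : 0 < b) (hba : b < a) :
    (a + 1) ^ ((a - b) * b) * (a + 2) ^ (a - b) * a ^ a ≤
      2 ^ (a * a + (a - b)) * b ^ a * (a - b + 1).factorial ^ b := by
  rcases lt_or_ge a 30 with ha | ha
  · exact (factorial_bounds_of_lt_thirty a ha b hba hb).2
  obtain ⟨c, rfl⟩ := Nat.exists_eq_add_of_lt hba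
  rw [show b + c + 1 - b = c + 1 by omega]
  set a := b + c + 1 with hadef
  have hf : (0 : ℝ) < (c + 1 + 1).factorial := by exact_mod_cast (c + 1 + 1).factorial_pos
  have ha0 : (0 : ℝ) < a := by positivity
  have hb0 : (0 : ℝ) < b := by exact_mod_cast hb
  suffices h : ((a : ℝ) + 1) ^ ((c + 1) * b) * (a + 2) ^ (c + 1) * a ^ a ≤
      2 ^ (a * a + (c + 1)) * (b : ℝ) ^ a * ((c + 1 + 1).factorial : ℝ) ^ b by exact_mod_cast h
  rw [← Real.log_le_log_iff (by positivity) (by positivity),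
    Real.log_mul (by positivity) (by positivity), Real.log_mul (by positivity) (by positivity),
    Real.log_mul (by positivity) (by positivity), Real.log_mul (by positivity) (by positivity),
    Real.log_pow, Real.log_pow, Real.log_pow, Real.log_pow, Real.log_pow, Real.log_pow]
  have h1 := log_pow_le_log_factorial_add (x := a + 1) (by omega) (c + 1 + 1)
  have ha' : (30 : ℝ) ≤ a := by exact_mod_cast ha
  have h2 := log_add_two_le ha'
  have h3 : Real.log a ≤ Real.log (a + 2) :=
    Real.log_le_log (by positivity) (by linarith)
  have hlb : 0 ≤ Real.log b := Real.log_nonneg (by exact_mod_cast hb)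
  have hl := Real.log_two_gt_d9
  have hl' := Real.log_two_lt_d9
  have h7 : 2 * Real.log 2 ≤ Real.log (a + 1) := by
    have : Real.log ((2 : ℝ) ^ 2) ≤ Real.log (a + 1) :=
      Real.log_le_log (by positivity) (by linarith)
    rw [Real.log_pow] at this
    exact_mod_cast this
  have hc : ((c + 1 : ℕ) : ℝ) = a - b := by rw [hadef]; push_cast; ring
  have hc' : (c : ℝ) + 1 = a - b := by rw [← hc]; push_cast; ring
  have hab : (b : ℝ) ≤ a := by exact_mod_cast hba.le
  have h4 := mul_le_mul_of_nonneg_left h1 hb0.le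
  have h5 := mul_le_mul_of_nonneg_left h2 (sub_nonneg.2 hab)
  have h8 := mul_le_mul_of_nonneg_left (h3.trans h2) ha0.le
  have h9 := mul_le_mul_of_nonneg_left h7 hb0.le
  have h10 := mul_nonneg ha0.le hlb
  push_cast at h4 ⊢
  rw [hc'] at *
  have h6 : 0 ≤ (Real.log 2 - 0.693) * (a * a - b * (a - b)) :=
    mul_nonneg (by linarith) (by nlinarith)
  have h11 : 0 ≤ (a - b : ℝ) * Real.log 2 := mul_nonneg (by linarith) (by linarith)
  have h12 : 0 ≤ b * (Real.log 2 - 0.693) := mul_nonneg hb0.le (by linarith)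
  nlinarith [sq_nonneg (a - 1.287 * b : ℝ)]

lemma pow_mul_descFactorial_le {m n b : ℕ} (hmn : m ≤ n) (d : ℕ) :
    n ^ d * (m - b).descFactorial d ≤ m ^ d * (n - b).descFactorial d := by
  induction d with
  | zero => simp
  | succ d ih =>
    rw [Nat.descFactorial_succ, Nat.descFactorial_succ, Nat.sub_sub, Nat.sub_sub]
    have h : n * (m - (b + d)) ≤ m * (n - (b + d)) := by
      rw [Nat.mul_sub, Nat.mul_sub, mul_comm n m]
      exact Nat.sub_le_sub_left (Nat.mul_le_mul_right _ hmn) _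
    calc n ^ (d + 1) * ((m - (b + d)) * (m - b).descFactorial d)
        = (n * (m - (b + d))) * (n ^ d * (m - b).descFactorial d) := by ring
      _ ≤ (m * (n - (b + d))) * (m ^ d * (n - b).descFactorial d) := by gcongr
      _ = _ := by ring

lemma tc_pow_mul_pow_le {s n a b d e K L Y : ℕ} (hba : b ≤ a) (hs : 0 < s) (hd : 0 < d)
    (han : a ≤ n) (hY : d * Y ≤ e * tc n a s)
    (hnum : n ^ ((a - b) * b) * e ^ (a - b) * K ≤
      d ^ (a - b) * L * (n - b).descFactorial (a - b) ^ b) :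
    tc n b s ^ a * Y ^ (a - b) * s.choose a ^ b * K ≤ L * s.choose b ^ a * tc n a s ^ a := by
  have h2 := tc_mul_pow_le hs n b
  have h3 := tc_mul_descFactorial_le hs n b (a - b)
  rw [Nat.add_sub_cancel' hba] at h3
  obtain ⟨c, rfl⟩ := Nat.exists_eq_add_of_le hba
  rw [Nat.add_sub_cancel_left] at *
  set F := (n - b).descFactorial c with hFdef
  set B := tc n b s
  set T := tc n (b + c) s
  have hF : 0 < F := Nat.descFactorial_pos.2 (by omega)
  refine Nat.le_of_mul_le_mul_left ?_ (show 0 < s ^ (b * c) * F ^ b * d ^ c by positivity)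
  calc s ^ (b * c) * F ^ b * d ^ c * (B ^ (b + c) * Y ^ c * s.choose (b + c) ^ b * K)
      = (B * s ^ b) ^ c * (B * s.choose (b + c) * F) ^ b * (d * Y) ^ c * K := by ring
    _ ≤ (s.choose b * n ^ b) ^ c * (s.choose b * s ^ c * T) ^ b * (e * T) ^ c * K := by gcongr
    _ = (s.choose b) ^ (b + c) * s ^ (b * c) * T ^ (b + c) * (n ^ (c * b) * e ^ c * K) := by ring
    _ ≤ (s.choose b) ^ (b + c) * s ^ (b * c) * T ^ (b + c) * (d ^ c * L * F ^ b) := by gcongr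
    _ = _ := by ring

lemma le_mul_rpow_of_pow_le {a b : ℕ} (ha : 0 < a) (hba : b ≤ a) {B Y C Z : ℝ} (hY : 0 < Y)
    (hC : 0 < C) (hZ : 0 ≤ Z) (h : B ^ a * Y ^ (a - b) * C ^ b ≤ Z ^ a) :
    B ≤ Z * C ^ (-((b : ℝ) / a)) * Y ^ ((b : ℝ) / a - 1) := by
  have ha' : (a : ℝ) ≠ 0 := by exact_mod_cast ha.ne'
  refine le_of_pow_le_pow_left₀ ha.ne' (by positivity) ?_
  have h1 : (C ^ (-((b : ℝ) / a))) ^ a = (C ^ b)⁻¹ := by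
    rw [← Real.rpow_mul_natCast hC.le, neg_mul, div_mul_cancel₀ _ ha', Real.rpow_neg hC.le,
      Real.rpow_natCast]
  have h2 : (Y ^ ((b : ℝ) / a - 1)) ^ a = (Y ^ (a - b))⁻¹ := by
    rw [← Real.rpow_mul_natCast hY.le, sub_mul, div_mul_cancel₀ _ ha', one_mul,
      ← neg_sub, Real.rpow_neg hY.le, ← Nat.cast_sub hba, Real.rpow_natCast]
  rw [mul_pow, mul_pow, h1, h2, ← div_eq_mul_inv, ← div_eq_mul_inv, le_div_iff₀ (by positivity),
    le_div_iff₀ (by positivity)]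
  exact h

/-- The bound `A * m ^ (b / a)` dominates the linear bound up to the first nontrivial value. -/
lemma choose_le_mul_rpow {s a b : ℕ} (hb : 0 < b) (hba : b < a) (has : a ≤ s) :
    (a.choose b : ℝ) ≤ s.choose b * 2 ^ a * (s.choose a : ℝ) ^ (-((b : ℝ) / a)) *
      (tc (a + 1) a s : ℝ) ^ ((b : ℝ) / a - 1) := by
  have hs : 0 < s := by omega
  have hpos : 0 < tc (a + 1) a s := tc_pos hs has (by omega)
  have hCpos : 0 < s.choose a := Nat.choose_pos has
  refine le_mul_rpow_of_pow_le (by omega) hba.le (by exact_mod_cast hpos)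
    (by exact_mod_cast hCpos) (by positivity) ?_
  have hY : 1 * tc (a + 1) a s ≤ (a + 1) * tc a a s := by
    have := tc_succ_left_le (n := a) (j := a - 1) hs 1 a (by omega)
      (by rw [show a - 1 + 1 = a by omega, show a - (a - 1) = 1 by omega]; omega)
    rwa [Nat.sub_add_cancel (by omega), add_comm 1 a] at this
  have h := tc_pow_mul_pow_le (K := 1) (L := 2 ^ (a * a)) hba.le hs one_pos le_rfl hY (by
    rw [Nat.descFactorial_self, one_pow, one_mul, mul_one]
    exact pow_mul_pow_le_factorial_pow hb hba)
  rw [tc_eq_choose has, tc_eq_choose has, Nat.choose_self, one_pow, mul_one, mul_one] at h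
  rw [mul_pow, ← pow_mul, mul_comm ((s.choose b : ℝ) ^ a)]
  exact_mod_cast h

lemma tc_le_mul_rpow {s n a b : ℕ} (hb : 0 < b) (hba : b < a) (has : a ≤ s) (hn : a + 1 ≤ n) :
    (tc n b s : ℝ) ≤ s.choose b * 2 ^ a * (s.choose a : ℝ) ^ (-((b : ℝ) / a)) * ((b : ℝ) / a) *
      (tc (n + 1) a s : ℝ) ^ ((b : ℝ) / a - 1) * tc n a s := by
  have hs : 0 < s := by omega
  have ha' : (a : ℝ) ≠ 0 := by
    have : a ≠ 0 := by omega
    exact_mod_cast this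
  have hpos : 0 < tc (n + 1) a s := tc_pos hs has (by omega)
  have hCpos : 0 < s.choose a := Nat.choose_pos has
  have hY : 2 * tc (n + 1) a s ≤ (a + 2) * tc n a s := by
    have := tc_succ_left_le (n := n) (j := a - 1) hs 2 a (by omega) (by
      rw [Nat.sub_add_cancel (by omega), mul_comm]
      exact Nat.mul_le_mul_left _ (by omega))
    rwa [Nat.sub_add_cancel (by omega), add_comm 2 a] at this
  have h := tc_pow_mul_pow_le (K := a ^ a) (L := 2 ^ (a * a) * b ^ a) hba.le hs two_pos
    (by omega) hY (by
      have hF : (a + 1 - b).descFactorial (a - b) = (a - b + 1).factorial := by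
        rw [show a + 1 - b = a - b + 1 by omega]
        have := Nat.factorial_mul_descFactorial (show a - b ≤ a - b + 1 by omega)
        rwa [Nat.add_sub_cancel_left, Nat.factorial_one, one_mul] at this
      have h1 := Nat.pow_le_pow_left (pow_mul_descFactorial_le (b := b) hn (a - b)) b
      rw [hF, mul_pow, mul_pow, ← pow_mul, ← pow_mul] at h1
      have h2 := succ_pow_mul_pow_le_factorial_pow hb hba
      refine Nat.le_of_mul_le_mul_left ?_
        (show 0 < (a - b + 1).factorial ^ b from pow_pos (Nat.factorial_pos _) _)
      set F := (a - b + 1).factorial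
      set G := (n - b).descFactorial (a - b)
      calc F ^ b * (n ^ ((a - b) * b) * (a + 2) ^ (a - b) * a ^ a)
          = (n ^ ((a - b) * b) * F ^ b) * ((a + 2) ^ (a - b) * a ^ a) := by ring
        _ ≤ ((a + 1) ^ ((a - b) * b) * G ^ b) * ((a + 2) ^ (a - b) * a ^ a) := by gcongr
        _ = ((a + 1) ^ ((a - b) * b) * (a + 2) ^ (a - b) * a ^ a) * G ^ b := by ring
        _ ≤ (2 ^ (a * a + (a - b)) * b ^ a * F ^ b) * G ^ b := by gcongr
        _ = _ := by rw [pow_add]; ring)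
  have h' : (tc n b s : ℝ) ≤ (s.choose b * 2 ^ a * ((b : ℝ) / a) * tc n a s) *
      (s.choose a : ℝ) ^ (-((b : ℝ) / a)) * (tc (n + 1) a s : ℝ) ^ ((b : ℝ) / a - 1) := by
    refine le_mul_rpow_of_pow_le (by omega) hba.le (by exact_mod_cast hpos)
      (by exact_mod_cast hCpos) (by positivity) ?_
    rw [mul_pow, mul_pow, mul_pow, div_pow, ← pow_mul]
    refine le_of_mul_le_mul_right ?_ (show (0 : ℝ) < (a : ℝ) ^ a by positivity)
    have hR : (s.choose b : ℝ) ^ a * 2 ^ (a * a) * ((b : ℝ) ^ a / (a : ℝ) ^ a) *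
        (tc n a s : ℝ) ^ a * (a : ℝ) ^ a =
        2 ^ (a * a) * (b : ℝ) ^ a * (s.choose b : ℝ) ^ a * (tc n a s : ℝ) ^ a := by
      field_simp
    rw [hR]
    exact_mod_cast h
  linarith

lemma jkr_spec {s a m : ℕ} (ha : 0 < a) (has : a ≤ s) (hm : 0 < m) :
    a ≤ jkr (s + 1) (a + 1) m ∧ tc (jkr (s + 1) (a + 1) m) a s ≤ m ∧
      m < tc (jkr (s + 1) (a + 1) m + 1) a s := by
  have hs : 0 < s := by omega
  have hab : a ≤ (m + 2) * (s + 1) := by nlinarith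
  have haa : tc a a s ≤ m := by
    rw [tc_eq_choose has, Nat.choose_self]
    exact hm
  simp only [jkr, Nat.add_sub_cancel]
  set N := Nat.findGreatest (fun n => tc n a s ≤ m) ((m + 2) * (s + 1)) with hN
  have h1 : a ≤ N := Nat.le_findGreatest hab haa
  have h2 : tc N a s ≤ m := Nat.findGreatest_spec (P := fun n => tc n a s ≤ m) hab haa
  refine ⟨h1, h2, ?_⟩
  by_contra! h3
  by_cases h4 : N + 1 ≤ (m + 2) * (s + 1)
  · exact Nat.findGreatest_is_greatest (P := fun n => tc n a s ≤ m) (Nat.lt_succ_self N) h4 h3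
  · exact absurd h3 (not_le.2 (lt_tc_of_mul_le hs ha has (by nlinarith)))

lemma dprk_eq {s a b m : ℕ} (ha : 0 < a) (has : a ≤ s) (hm : 0 < m) :
    dprk (b + 1) (s + 1) (a + 1) m = tc (jkr (s + 1) (a + 1) m) b s +
      dprk (b + 1) (s + 1) (a + 1) (m - tc (jkr (s + 1) (a + 1) m) a s) := by
  have hpos : 1 ≤ tc (jkr (s + 1) (a + 1) m) a s :=
    tc_pos (by omega) has (jkr_spec ha has hm).1
  obtain ⟨m, rfl⟩ := Nat.exists_eq_succ_of_ne_zero hm.ne'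
  rw [dprk]
  simp only [Nat.add_sub_cancel, Nat.succ_eq_add_one] at hpos ⊢
  rw [max_eq_right hpos]

lemma rpow_le_rpow_add_mul {x y β : ℝ} (hx : 0 ≤ x) (hy : 0 < y) (h0 : 0 ≤ β) (h1 : β ≤ 1) :
    x ^ β ≤ y ^ β + β * y ^ (β - 1) * (x - y) := by
  have h := rpow_one_add_le_one_add_mul_self (s := x / y - 1)
    (by have := div_nonneg hx hy.le; linarith) h0 h1
  rw [add_sub_cancel, Real.div_rpow hx hy.le, div_le_iff₀ (by positivity)] at h
  rw [Real.rpow_sub_one hy.ne']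
  calc x ^ β ≤ _ := h
    _ = _ := by field_simp

/-- The greedy sums are bounded by a function that is linear up to the second value of
`tc · a s` and a shifted power function from there on. -/
lemma dprk_le_of_tc_le {s a b : ℕ} (ha : 0 < a) (has : a ≤ s) {M A β : ℝ} (hA : 0 ≤ A)
    (h0 : 0 ≤ β) (h1 : β ≤ 1) (hM : ∀ n, a ≤ n → (tc n b s : ℝ) ≤ M * tc n a s)
    (hP : ∀ n, a + 1 ≤ n →
      (tc n b s : ℝ) ≤ A * β * (tc (n + 1) a s : ℝ) ^ (β - 1) * tc n a s) (m : ℕ) :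
    (dprk (b + 1) (s + 1) (a + 1) m : ℝ) ≤ M * m ∧ (tc (a + 1) a s ≤ m →
      (dprk (b + 1) (s + 1) (a + 1) m : ℝ) ≤
        M * tc (a + 1) a s + A * ((m : ℝ) ^ β - (tc (a + 1) a s : ℝ) ^ β)) := by
  have hs : 0 < s := by omega
  have hx0 : 0 < tc (a + 1) a s := tc_pos hs has (by omega)
  set x := tc (a + 1) a s
  induction m using Nat.strong_induction_on with
  | _ m ih =>
    rcases Nat.eq_zero_or_pos m with rfl | hm
    · refine ⟨by simp [dprk], fun h => ?_⟩
      omega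
    obtain ⟨hN, hT, hY⟩ := jkr_spec ha has hm
    rw [dprk_eq ha has hm]
    set N := jkr (s + 1) (a + 1) m
    have hTpos : 0 < tc N a s := tc_pos hs has hN
    obtain ⟨R, hR⟩ := Nat.exists_eq_add_of_le hT
    have hsub : m - tc N a s = R := by omega
    obtain ⟨ih1, ih2⟩ := ih R (by omega)
    rw [hsub]
    have hMN := hM N hN
    have hmR : (m : ℝ) = tc N a s + R := by exact_mod_cast hR
    have hT' : (0 : ℝ) < tc N a s := by exact_mod_cast hTpos
    push_cast
    refine ⟨by rw [hmR]; linarith, fun hxm => ?_⟩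
    have hN1 : a + 1 ≤ N := by
      rcases hN.eq_or_lt with h | h
      · rw [← h] at hY
        exact absurd hY (not_lt.2 hxm)
      · exact h
    have hm' : (0 : ℝ) < m := by exact_mod_cast hm
    have hγ : (tc N b s : ℝ) ≤ A * β * (m : ℝ) ^ (β - 1) * tc N a s := by
      refine (hP N hN1).trans ?_
      gcongr A * β * ?_ * _
      exact Real.rpow_le_rpow_of_nonpos hm' (by exact_mod_cast hY.le) (by linarith)
    have tangent : ∀ z : ℝ, 0 ≤ z →
        A * z ^ β ≤ A * (m : ℝ) ^ β - A * β * (m : ℝ) ^ (β - 1) * (m - z) := fun z hz => by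
      have := mul_le_mul_of_nonneg_left (rpow_le_rpow_add_mul hz hm' h0 h1) hA
      linarith
    set γ := A * β * (m : ℝ) ^ (β - 1)
    rcases le_or_gt x R with hxR | hxR
    · have h2 := ih2 hxR
      have h3 := tangent R R.cast_nonneg
      rw [show (m : ℝ) - R = tc N a s by linarith] at h3
      linarith
    · have h3 := tangent x x.cast_nonneg
      have hxm' : (0 : ℝ) ≤ m - x := sub_nonneg.2 (by exact_mod_cast hxm)
      have hxR' : (0 : ℝ) ≤ x - R := sub_nonneg.2 (by exact_mod_cast hxR.le)
      set u := (tc N b s : ℝ) / tc N a s with hu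
      have hu1 : u ≤ M := (div_le_iff₀ hT').2 hMN
      have hu2 : u ≤ γ := (div_le_iff₀ hT').2 hγ
      have hB : (tc N b s : ℝ) = u * (m - x) + u * (x - R) := by
        rw [hu, ← mul_add, show (m : ℝ) - x + (x - R) = tc N a s by linarith,
          div_mul_cancel₀ _ hT'.ne']
      have h4 := mul_le_mul_of_nonneg_right hu1 hxR'
      have h5 := mul_le_mul_of_nonneg_right hu2 hxm'
      linarith

/-- Let `r ≥ k > p > 1` be integers.  Then for every natural number `m`,
`d_{p,r}^k(m) ≤ C(r-1, p-1) · C(r-1, k-1)^(−(p-1)/(k-1)) · 2^(k-1) · m^((p-1)/(k-1))`. -/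
theorem stmt_13 (r k p : ℕ) (hp : 1 < p) (hpk : p < k) (hkr : k ≤ r) (m : ℕ) :
    (dprk p r k m : ℝ) ≤
      (Nat.choose (r - 1) (p - 1) : ℝ) *
        (Nat.choose (r - 1) (k - 1) : ℝ) ^ (-(((p : ℝ) - 1) / ((k : ℝ) - 1))) *
        2 ^ ((k : ℝ) - 1) * (m : ℝ) ^ (((p : ℝ) - 1) / ((k : ℝ) - 1)) := by
  obtain ⟨b, rfl⟩ : ∃ b, p = b + 1 := ⟨p - 1, by omega⟩
  obtain ⟨a, rfl⟩ : ∃ a, k = a + 1 := ⟨k - 1, by omega⟩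
  obtain ⟨s, rfl⟩ : ∃ s, r = s + 1 := ⟨r - 1, by omega⟩
  have hb : 0 < b := by omega
  have hba : b < a := by omega
  have has : a ≤ s := by omega
  have hs : 0 < s := by omega
  have ha' : (0 : ℝ) < a := by exact_mod_cast hb.trans hba
  simp only [Nat.add_sub_cancel, Nat.cast_add, Nat.cast_one, add_sub_cancel_right,
    Real.rpow_natCast]
  set β : ℝ := (b : ℝ) / a with hβ
  have hβ0 : 0 ≤ β := by positivity
  have hβ1 : β ≤ 1 := (div_le_one ha').2 (by exact_mod_cast hba.le)
  set A : ℝ := s.choose b * 2 ^ a * (s.choose a : ℝ) ^ (-β) with hA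
  have hA0 : 0 ≤ A := by positivity
  have hx : (0 : ℝ) < tc (a + 1) a s := by
    exact_mod_cast tc_pos hs has (Nat.le_succ a)
  have hbase : (a.choose b : ℝ) ≤ A * (tc (a + 1) a s : ℝ) ^ (β - 1) :=
    choose_le_mul_rpow hb hba has
  obtain ⟨h1, h2⟩ := dprk_le_of_tc_le (b := b) (M := a.choose b) (by omega) has hA0 hβ0 hβ1
    (fun n hn => by exact_mod_cast tc_le_choose_mul hs hba.le has hn)
    (fun n hn => tc_le_mul_rpow hb hba has hn) m
  rw [show (s.choose b : ℝ) * (s.choose a : ℝ) ^ (-β) * 2 ^ a * (m : ℝ) ^ β = A * (m : ℝ) ^ β by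
    rw [hA]; ring]
  rcases Nat.eq_zero_or_pos m with rfl | hm
  · refine h1.trans ?_
    rw [Nat.cast_zero, mul_zero]
    positivity
  have hm' : (0 : ℝ) < m := by exact_mod_cast hm
  rcases le_or_gt (tc (a + 1) a s) m with hxm | hxm
  · have h3 := mul_le_mul_of_nonneg_right hbase hx.le
    rw [mul_assoc, Real.rpow_sub_one hx.ne', div_mul_cancel₀ _ hx.ne'] at h3
    linarith [h2 hxm]
  · have h3 : (a.choose b : ℝ) ≤ A * (m : ℝ) ^ (β - 1) := by
      refine hbase.trans ?_
      gcongr A * ?_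
      exact Real.rpow_le_rpow_of_nonpos hm' (by exact_mod_cast hxm.le) (by linarith)
    have h4 := mul_le_mul_of_nonneg_right h3 hm'.le
    rw [mul_assoc, Real.rpow_sub_one hm'.ne', div_mul_cancel₀ _ hm'.ne'] at h4
    exact h1.trans h4
end

section
/- Let r ≥ k > p > 1 be integers. Then the limit as m → ∞ of d_{p,r}^k(m) / m^((p-1)/(k-1)) exists and equals C(r-1, p-1) · C(r-1, k-1)^(−(p-1)/(k-1)). -/
open Filter Topology

/-- The set of numbers `i + R * g i` with `i` ranging over `S`: one number in each residue class
modulo `R` that belongs to `S`. -/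
def transversal (R q a : ℕ)
    (x : Σ S : {S : Finset (Fin R) // S.card = q}, ({i // i ∈ S.1} → Fin a)) : Finset ℕ :=
  Finset.univ.image fun i => (i.1 : ℕ) + R * (x.2 i : ℕ)

theorem mem_transversal {R q a : ℕ}
    {x : Σ S : {S : Finset (Fin R) // S.card = q}, ({i // i ∈ S.1} → Fin a)} {n : ℕ} :
    n ∈ transversal R q a x ↔ ∃ i, (i.1 : ℕ) + R * (x.2 i : ℕ) = n := by
  simp [transversal]

theorem residue_add_mul_mod {R : ℕ} (i : Fin R) (b : ℕ) : ((i : ℕ) + R * b) % R = i := by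
  rw [Nat.add_mul_mod_self_left, Nat.mod_eq_of_lt i.2]

theorem card_transversal {R q a : ℕ}
    (x : Σ S : {S : Finset (Fin R) // S.card = q}, ({i // i ∈ S.1} → Fin a)) :
    (transversal R q a x).card = q := by
  rw [transversal, Finset.card_image_of_injective]
  · simpa using x.1.2
  · intro i j h
    have := congrArg (· % R) h
    simp only [residue_add_mul_mod] at this
    exact Subtype.ext (Fin.ext this)

theorem transversal_injective (R q a : ℕ) : Function.Injective (transversal R q a) := by
  have key : ∀ x y : Σ S : {S : Finset (Fin R) // S.card = q}, ({i // i ∈ S.1} → Fin a),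
      transversal R q a x = transversal R q a y →
      ∀ i (hi : i ∈ x.1.1), ∃ hi' : i ∈ y.1.1, x.2 ⟨i, hi⟩ = y.2 ⟨i, hi'⟩ := by
    intro x y h i hi
    have hm : (i : ℕ) + R * (x.2 ⟨i, hi⟩ : ℕ) ∈ transversal R q a y :=
      h ▸ mem_transversal.2 ⟨⟨i, hi⟩, rfl⟩
    obtain ⟨⟨j, hj⟩, hji⟩ := mem_transversal.1 hm
    have hmod := congrArg (· % R) hji
    simp only [residue_add_mul_mod] at hmod
    obtain rfl : j = i := Fin.ext hmod
    refine ⟨hj, Fin.ext ?_⟩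
    exact (Nat.eq_of_mul_eq_mul_left j.pos (Nat.add_left_cancel hji)).symm
  intro x y h
  have hS : x.1 = y.1 := by
    refine Subtype.ext (Finset.ext fun i => ⟨fun hi => (key x y h i hi).1, fun hi => ?_⟩)
    exact (key y x h.symm i hi).1
  obtain ⟨S, f⟩ := x
  obtain ⟨S', g⟩ := y
  obtain rfl : S = S' := hS
  congr 1
  funext ⟨i, hi⟩
  exact (key _ _ h i hi).2

theorem card_transversal_index (R q a : ℕ) :
    Nat.card (Σ S : {S : Finset (Fin R) // S.card = q}, ({i // i ∈ S.1} → Fin a)) =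
      R.choose q * a ^ q := by
  rw [Nat.card_eq_fintype_card, Fintype.card_sigma]
  have h : ∀ S : {S : Finset (Fin R) // S.card = q},
      Fintype.card ({i // i ∈ S.1} → Fin a) = a ^ q := by
    intro S
    simp [S.2]
  simp [h]

/-- Cliques of the Turán graph as sets of numbers that are distinct modulo `R`. -/
theorem tc_eq_ncard (n q R : ℕ) :
    tc n q R = {A : Finset ℕ | A ⊆ Finset.range n ∧ A.card = q ∧
      Set.InjOn (· % R) (A : Set ℕ)}.ncard := by
  rw [tc, ← Set.ncard_image_of_injective _ (Finset.map_injective Fin.valEmbedding)]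
  congr 1
  ext A
  simp only [Set.mem_image, Set.mem_ofPred_eq, SimpleGraph.mem_cliqueSet_iff,
    SimpleGraph.isNClique_iff, SimpleGraph.isClique_iff]
  constructor
  · rintro ⟨B, ⟨hB, hc⟩, rfl⟩
    refine ⟨?_, by simpa using hc, ?_⟩
    · intro x hx
      obtain ⟨y, -, rfl⟩ := Finset.mem_map.1 hx
      simp
    · intro x hx y hy hxy
      obtain ⟨x, hxB, rfl⟩ := Finset.mem_map.1 (Finset.mem_coe.1 hx)
      obtain ⟨y, hyB, rfl⟩ := Finset.mem_map.1 (Finset.mem_coe.1 hy)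
      by_contra hne
      exact hB hxB hyB (fun h => hne (by rw [h])) hxy
  · rintro ⟨hA, hc, hinj⟩
    refine ⟨A.attachFin fun x hx => Finset.mem_range.1 (hA hx), ⟨?_, by simpa using hc⟩, ?_⟩
    · intro x hx y hy hne hxy
      refine hne (Fin.ext (hinj ?_ ?_ hxy))
      · simpa using hx
      · simpa using hy
    · ext x
      simp only [Finset.mem_map, Finset.mem_attachFin, Fin.valEmbedding_apply]
      exact ⟨fun ⟨y, hy, h⟩ => h ▸ hy, fun hx => ⟨⟨x, Finset.mem_range.1 (hA hx)⟩, hx, rfl⟩⟩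

theorem choose_mul_pow_le_tc (n q R : ℕ) : R.choose q * (n / R) ^ q ≤ tc n q R := by
  rw [tc_eq_ncard, ← card_transversal_index, ← Set.ncard_univ,
    ← Set.ncard_image_of_injective _ (transversal_injective R q (n / R)), Set.image_univ]
  refine Set.ncard_le_ncard ?_ ((Finset.finite_toSet (Finset.range n).powerset).subset
    fun A hA => Finset.mem_coe.2 (Finset.mem_powerset.2 hA.1))
  rintro _ ⟨x, rfl⟩
  refine ⟨?_, card_transversal x, ?_⟩
  · intro m hm
    obtain ⟨i, rfl⟩ := mem_transversal.1 hm
    have h1 : R * ((x.2 i : ℕ) + 1) ≤ R * (n / R) := Nat.mul_le_mul_left _ (x.2 i).2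
    have h2 := Nat.mul_div_le n R
    have h3 := i.1.2
    rw [Finset.mem_range]
    linarith
  · intro m hm m' hm' h
    obtain ⟨i, rfl⟩ := mem_transversal.1 (Finset.mem_coe.1 hm)
    obtain ⟨j, rfl⟩ := mem_transversal.1 (Finset.mem_coe.1 hm')
    simp only [residue_add_mul_mod] at h
    obtain rfl : i = j := Subtype.ext (Fin.ext h)
    rfl

theorem tc_le_choose_mul_pow (n q : ℕ) {R : ℕ} (hR : 0 < R) :
    tc n q R ≤ R.choose q * (n / R + 1) ^ q := by
  rw [tc_eq_ncard, ← card_transversal_index, ← Set.ncard_univ,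
    ← Set.ncard_image_of_injective _ (transversal_injective R q (n / R + 1)), Set.image_univ]
  refine Set.ncard_le_ncard ?_ (Set.finite_range _)
  rintro A ⟨hA, hc, hinj⟩
  let res : ℕ → Fin R := fun m => ⟨m % R, Nat.mod_lt _ hR⟩
  have hres : Set.InjOn res (A : Set ℕ) := fun x hx y hy h => hinj hx hy (congrArg Fin.val h)
  have hex : ∀ i : {i // i ∈ A.image res}, ∃ m ∈ A, res m = i.1 := fun i =>
    Finset.mem_image.1 i.2
  choose f hfA hf using hex
  have hlt : ∀ i, f i / R < n / R + 1 := fun i =>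
    Nat.lt_succ_of_le (Nat.div_le_div_right (Finset.mem_range.1 (hA (hfA i))).le)
  have hval : ∀ i, (i.1 : ℕ) + R * (f i / R) = f i := by
    intro i
    rw [← congrArg Fin.val (hf i)]
    exact Nat.mod_add_div _ _
  refine ⟨⟨⟨A.image res, by rw [Finset.card_image_of_injOn hres, hc]⟩,
    fun i => ⟨f i / R, hlt i⟩⟩, ?_⟩
  ext m
  rw [mem_transversal]
  constructor
  · rintro ⟨i, rfl⟩
    change (i.1 : ℕ) + R * (f i / R) ∈ A
    rw [hval]
    exact hfA i
  · intro hm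
    have hi : res m ∈ A.image res := Finset.mem_image_of_mem _ hm
    refine ⟨⟨res m, hi⟩, ?_⟩
    change ((⟨res m, hi⟩ : {i // i ∈ A.image res}).1 : ℕ) + R * (f ⟨res m, hi⟩ / R) = m
    rw [hval]
    exact hres (hfA _) hm (hf _)

theorem tendsto_natDiv_div_self {R : ℕ} (hR : 0 < R) :
    Tendsto (fun n : ℕ => ((n / R : ℕ) : ℝ) / n) atTop (𝓝 (1 / R)) := by
  have hR' : (0 : ℝ) < R := Nat.cast_pos.2 hR
  have hlow : Tendsto (fun n : ℕ => 1 / (R : ℝ) - 1 / (n : ℝ)) atTop (𝓝 (1 / R)) := by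
    simpa using tendsto_const_nhds.sub (tendsto_one_div_atTop_nhds_zero_nat (𝕜 := ℝ))
  refine tendsto_of_tendsto_of_tendsto_of_le_of_le' hlow tendsto_const_nhds ?_ ?_
  · filter_upwards [eventually_gt_atTop 0] with n hn
    have hn' : (0 : ℝ) < n := Nat.cast_pos.2 hn
    have h : (n : ℝ) ≤ R * ((n / R : ℕ) + 1) := by exact_mod_cast (Nat.lt_mul_div_succ n hR).le
    rw [le_div_iff₀ hn', sub_mul, one_div_mul_cancel hn'.ne', one_div_mul_eq_div,
      sub_le_iff_le_add, div_le_iff₀ hR']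
    linarith
  · filter_upwards [eventually_gt_atTop 0] with n hn
    have hn' : (0 : ℝ) < n := Nat.cast_pos.2 hn
    rw [div_le_iff₀ hn', one_div_mul_eq_div]
    exact Nat.cast_div_le

theorem tendsto_tc_div_pow (q : ℕ) {R : ℕ} (hR : 0 < R) :
    Tendsto (fun n : ℕ => (tc n q R : ℝ) / (n : ℝ) ^ q) atTop
      (𝓝 ((R.choose q : ℝ) * (1 / R) ^ q)) := by
  have h := tendsto_natDiv_div_self hR
  have h' : Tendsto (fun n : ℕ => ((n / R : ℕ) : ℝ) / n + 1 / (n : ℝ)) atTop (𝓝 (1 / R)) := by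
    simpa using h.add (tendsto_one_div_atTop_nhds_zero_nat (𝕜 := ℝ))
  refine tendsto_of_tendsto_of_tendsto_of_le_of_le ((h.pow q).const_mul _)
    ((h'.pow q).const_mul _) (fun n => ?_) (fun n => ?_)
  · rw [div_pow, ← mul_div_assoc]
    gcongr
    exact_mod_cast choose_mul_pow_le_tc n q R
  · simp only
    rw [← add_div, div_pow, ← mul_div_assoc]
    gcongr
    exact_mod_cast tc_le_choose_mul_pow n q hR

/-- If `d m = t m + d (e m)` with `e m = o(m)`, then `d` has the same power asymptotics as `t`. -/
theorem tendsto_div_rpow_of_recursion {β c : ℝ} (hβ : 0 < β) {d t e : ℕ → ℕ}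
    (hd : ∀ᶠ m in atTop, d m = t m + d (e m))
    (he : Tendsto (fun m : ℕ => (e m : ℝ) / m) atTop (𝓝 0))
    (ht : Tendsto (fun m : ℕ => (t m : ℝ) / (m : ℝ) ^ β) atTop (𝓝 c)) :
    Tendsto (fun m : ℕ => (d m : ℝ) / (m : ℝ) ^ β) atTop (𝓝 c) := by
  have hc : 0 ≤ c := ge_of_tendsto' ht fun m => by positivity
  obtain ⟨M, hM⟩ := eventually_atTop.1 (((hd.and (he.eventually_le_const (by norm_num :
    (0 : ℝ) < 1 / 2))).and (ht.eventually_le_const (lt_add_one c))).and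
    (eventually_gt_atTop 0))
  have hθ : ((1 : ℝ) / 2) ^ β < 1 := Real.rpow_lt_one (by norm_num) (by norm_num) hβ
  set θ : ℝ := (1 / 2) ^ β with hθdef
  set K : ℝ := (c + 1) / (1 - θ) with hK
  have hKpos : 0 ≤ K := div_nonneg (by linarith) (by linarith)
  have hKeq : c + 1 + K * θ = K := by
    have : (1 - θ) ≠ 0 := by linarith
    rw [hK]
    field_simp
    ring
  set L : ℕ := ∑ i ∈ Finset.range M, d i
  have hbound : ∀ m : ℕ, (d m : ℝ) ≤ K * (m : ℝ) ^ β + L := by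
    intro m
    induction m using Nat.strong_induction_on with
    | _ m ih =>
      by_cases hm : m < M
      · have h1 : d m ≤ L :=
          Finset.single_le_sum (f := d) (fun _ _ => Nat.zero_le _) (Finset.mem_range.2 hm)
        have h2 : (d m : ℝ) ≤ L := by exact_mod_cast h1
        have h3 : 0 ≤ K * (m : ℝ) ^ β := by positivity
        linarith
      · obtain ⟨⟨⟨h1, h2⟩, h3⟩, h4⟩ := hM m (not_lt.1 hm)
        have hm0 : (0 : ℝ) < m := Nat.cast_pos.2 h4
        rw [div_le_iff₀ hm0] at h2
        rw [div_le_iff₀ (by positivity)] at h3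
        have hlt : e m < m := by
          have : (e m : ℝ) < m := by linarith
          exact_mod_cast this
        have h5 := ih _ hlt
        have h6 : (e m : ℝ) ^ β ≤ θ * (m : ℝ) ^ β := by
          rw [hθdef, ← Real.mul_rpow (by norm_num) hm0.le]
          exact Real.rpow_le_rpow (by positivity) h2 hβ.le
        have h7 := mul_le_mul_of_nonneg_left h6 hKpos
        rw [h1]
        push_cast
        calc (t m : ℝ) + d (e m) ≤ (c + 1) * (m : ℝ) ^ β + (K * (θ * (m : ℝ) ^ β) + L) := by
              linarith
          _ = (c + 1 + K * θ) * (m : ℝ) ^ β + L := by ring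
          _ = K * (m : ℝ) ^ β + L := by rw [hKeq]
  have hpow : Tendsto (fun m : ℕ => (m : ℝ) ^ β) atTop atTop :=
    (tendsto_rpow_atTop hβ).comp tendsto_natCast_atTop_atTop
  have hsmall : Tendsto (fun m : ℕ => K * ((e m : ℝ) / m) ^ β + L / (m : ℝ) ^ β) atTop (𝓝 0) := by
    have h1 := (he.rpow_const (Or.inr hβ.le)).const_mul K
    rw [Real.zero_rpow hβ.ne', mul_zero] at h1
    simpa using h1.add (hpow.const_div_atTop (L : ℝ))
  have hrem : Tendsto (fun m : ℕ => (d (e m) : ℝ) / (m : ℝ) ^ β) atTop (𝓝 0) := by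
    refine squeeze_zero (fun m => by positivity) (fun m => ?_) hsmall
    rw [Real.div_rpow (by positivity) (by positivity), ← mul_div_assoc, ← add_div]
    gcongr
    exact hbound _
  have hsum := ht.add hrem
  rw [add_zero] at hsum
  refine hsum.congr' ?_
  filter_upwards [hd] with m hm
  rw [hm, ← add_div]
  push_cast
  rfl

theorem tc_jkr_le {r k : ℕ} (hk : 1 < k) (m : ℕ) :
    tc (jkr r k m) (k - 1) (r - 1) ≤ m := by
  refine Nat.findGreatest_spec (P := fun n => tc n (k - 1) (r - 1) ≤ m) (Nat.zero_le _) ?_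
  rw [tc_eq_ncard]
  have : {A : Finset ℕ | A ⊆ Finset.range 0 ∧ A.card = k - 1 ∧
      Set.InjOn (· % (r - 1)) (A : Set ℕ)} = ∅ := by
    refine Set.eq_empty_of_forall_notMem fun A hA => ?_
    have h0 : A = ∅ := by simpa using hA.1
    have h1 := hA.2.1
    rw [h0, Finset.card_empty] at h1
    omega
  rw [this, Set.ncard_empty]
  exact Nat.zero_le m

theorem lt_tc_jkr_add_one {r k : ℕ} (hk : 1 < k) (hkr : k ≤ r) (m : ℕ) :
    m < tc (jkr r k m + 1) (k - 1) (r - 1) := by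
  have hlarge : m < tc ((m + 2) * r) (k - 1) (r - 1) := by
    refine lt_of_lt_of_le ?_ (choose_mul_pow_le_tc _ _ _)
    have h1 : m + 2 ≤ (m + 2) * r / (r - 1) :=
      (Nat.le_div_iff_mul_le (by omega)).2 (Nat.mul_le_mul_left _ (Nat.sub_le _ _))
    have h2 : (m + 2) * r / (r - 1) ≤ ((m + 2) * r / (r - 1)) ^ (k - 1) :=
      Nat.le_self_pow (by omega) _
    have h3 : 0 < (r - 1).choose (k - 1) := Nat.choose_pos (by omega)
    have h4 := Nat.le_mul_of_pos_left (((m + 2) * r / (r - 1)) ^ (k - 1)) h3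
    omega
  have hlt : jkr r k m < (m + 2) * r := by
    refine lt_of_le_of_ne (Nat.findGreatest_le _) fun h => ?_
    have := tc_jkr_le (r := r) hk m
    rw [h] at this
    omega
  exact not_le.1 (Nat.findGreatest_is_greatest
    (P := fun n => tc n (k - 1) (r - 1) ≤ m) (Nat.lt_succ_self _) hlt)

theorem tendsto_jkr {r k : ℕ} (hk : 1 < k) (hkr : k ≤ r) :
    Tendsto (jkr r k) atTop atTop := by
  refine tendsto_atTop.2 fun N => ?_
  filter_upwards [eventually_ge_atTop (∑ n ∈ Finset.range (N + 1), tc n (k - 1) (r - 1))]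
    with m hm
  by_contra! h
  have h1 := lt_tc_jkr_add_one hk hkr m
  have h2 := Finset.single_le_sum (f := fun n => tc n (k - 1) (r - 1))
    (fun _ _ => Nat.zero_le _) (Finset.mem_range.2 (Nat.succ_lt_succ h))
  exact absurd (h1.trans_le (h2.trans hm)) (lt_irrefl _)

theorem tendsto_div_jkr_pow {r k : ℕ} (hk : 1 < k) (hkr : k ≤ r) :
    Tendsto (fun m : ℕ => (m : ℝ) / (jkr r k m : ℝ) ^ (k - 1)) atTop
      (𝓝 (((r - 1).choose (k - 1) : ℝ) * (1 / (r - 1 : ℕ)) ^ (k - 1))) := by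
  have hj := tendsto_jkr hk hkr
  have hT := tendsto_tc_div_pow (k - 1) (R := r - 1) (by omega)
  have hratio : Tendsto (fun n : ℕ => (((n + 1 : ℕ) : ℝ) / n) ^ (k - 1)) atTop (𝓝 1) := by
    have h1 : Tendsto (fun n : ℕ => 1 + 1 / (n : ℝ)) atTop (𝓝 1) := by
      simpa using tendsto_const_nhds.add (tendsto_one_div_atTop_nhds_zero_nat (𝕜 := ℝ))
    have h2 := h1.pow (k - 1)
    rw [one_pow] at h2
    refine h2.congr' ?_
    filter_upwards [eventually_gt_atTop 0] with n hn
    have : (n : ℝ) ≠ 0 := by positivity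
    push_cast
    rw [add_div, div_self this]
  have hup : Tendsto (fun n : ℕ => (tc (n + 1) (k - 1) (r - 1) : ℝ) / (n : ℝ) ^ (k - 1)) atTop
      (𝓝 (((r - 1).choose (k - 1) : ℝ) * (1 / (r - 1 : ℕ)) ^ (k - 1))) := by
    have h := (hT.comp (tendsto_add_atTop_nat 1)).mul hratio
    rw [mul_one] at h
    refine h.congr fun n => ?_
    have : ((n + 1 : ℕ) : ℝ) ≠ 0 := by positivity
    simp only [Function.comp_apply]
    rw [div_pow, div_mul_div_cancel₀ (pow_ne_zero _ this)]
  refine tendsto_of_tendsto_of_tendsto_of_le_of_le (hT.comp hj) (hup.comp hj)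
    (fun m => ?_) (fun m => ?_)
  · simp only [Function.comp_apply]
    gcongr
    exact tc_jkr_le hk m
  · simp only [Function.comp_apply]
    gcongr
    exact (lt_tc_jkr_add_one hk hkr m).le

theorem tendsto_remainder_div {r k : ℕ} (hk : 1 < k) (hkr : k ≤ r) :
    Tendsto (fun m : ℕ => ((m - max 1 (tc (jkr r k m) (k - 1) (r - 1)) : ℕ) : ℝ) / m) atTop
      (𝓝 0) := by
  have hc : ((r - 1).choose (k - 1) : ℝ) * (1 / (r - 1 : ℕ)) ^ (k - 1) ≠ 0 := by
    have h1 : 0 < (r - 1).choose (k - 1) := Nat.choose_pos (by omega)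
    have h2 : 0 < r - 1 := by omega
    positivity
  have h := (((tendsto_tc_div_pow (k - 1) (R := r - 1) (by omega)).comp
    (tendsto_jkr hk hkr)).div (tendsto_div_jkr_pow hk hkr) hc).const_sub 1
  rw [div_self hc, sub_self] at h
  refine squeeze_zero' (Eventually.of_forall fun m => by positivity) ?_ h
  filter_upwards [eventually_gt_atTop 0, (tendsto_jkr hk hkr).eventually_gt_atTop 0] with m hm hj
  have hm' : (0 : ℝ) < m := Nat.cast_pos.2 hm
  have hj' : (jkr r k m : ℝ) ^ (k - 1) ≠ 0 := by positivity
  simp only [Function.comp_apply, Pi.div_apply]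
  rw [div_div_div_cancel_right₀ hj', ← div_self hm'.ne', ← sub_div,
    ← Nat.cast_sub (tc_jkr_le hk m)]
  gcongr
  exact le_max_right _ _



open Filter in
/-- Let `r ≥ k > p > 1` be integers.  Then
`d_{p,r}^k(m) / m^((p-1)/(k-1)) → C(r-1, p-1) · C(r-1, k-1)^(−(p-1)/(k-1))` as `m → ∞`. -/
theorem stmt_14 (r k p : ℕ) (hp : 1 < p) (hpk : p < k) (hkr : k ≤ r) :
    Tendsto (fun m : ℕ => (dprk p r k m : ℝ) / (m : ℝ) ^ (((p : ℝ) - 1) / ((k : ℝ) - 1)))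
      atTop
      (nhds ((Nat.choose (r - 1) (p - 1) : ℝ) *
        (Nat.choose (r - 1) (k - 1) : ℝ) ^ (-(((p : ℝ) - 1) / ((k : ℝ) - 1))))) := by
  have hk : 1 < k := hp.trans hpk
  have hp1 : ((p - 1 : ℕ) : ℝ) = (p : ℝ) - 1 := by push_cast [Nat.cast_sub hp.le]; rfl
  have hk1 : ((k - 1 : ℕ) : ℝ) = (k : ℝ) - 1 := by push_cast [Nat.cast_sub hk.le]; rfl
  have hppos : (0 : ℝ) < (p : ℝ) - 1 := sub_pos.2 (by exact_mod_cast hp)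
  have hkpos : (0 : ℝ) < (k : ℝ) - 1 := sub_pos.2 (by exact_mod_cast hk)
  set β : ℝ := ((p : ℝ) - 1) / ((k : ℝ) - 1) with hβdef
  have hβ : 0 < β := div_pos hppos hkpos
  have hpow : ∀ x : ℝ, 0 ≤ x → (x ^ (k - 1)) ^ β = x ^ (p - 1) := by
    intro x hx
    rw [← Real.rpow_natCast, ← Real.rpow_mul hx, hk1, hβdef, mul_div_cancel₀ _ hkpos.ne',
      ← hp1, Real.rpow_natCast]
  have hR : (0 : ℝ) < ((r - 1 : ℕ) : ℝ) := Nat.cast_pos.2 (by omega)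
  have hC : (0 : ℝ) < ((r - 1).choose (k - 1) : ℝ) :=
    Nat.cast_pos.2 (Nat.choose_pos (by omega))
  refine tendsto_div_rpow_of_recursion hβ (t := fun m => tc (jkr r k m) (p - 1) (r - 1))
    (e := fun m => m - max 1 (tc (jkr r k m) (k - 1) (r - 1))) ?_
    (tendsto_remainder_div hk hkr) ?_
  · filter_upwards [eventually_gt_atTop 0] with m hm
    obtain ⟨m, rfl⟩ := Nat.exists_eq_succ_of_ne_zero hm.ne'
    rw [Nat.succ_eq_add_one, dprk]
  · have hc : ((r - 1).choose (k - 1) : ℝ) * (1 / (r - 1 : ℕ)) ^ (k - 1) ≠ 0 := by positivity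
    have h := ((tendsto_tc_div_pow (p - 1) (R := r - 1) (by omega)).comp
      (tendsto_jkr hk hkr)).div ((tendsto_div_jkr_pow hk hkr).rpow_const
        (p := β) (Or.inr hβ.le)) (by positivity)
    rw [Real.mul_rpow hC.le (by positivity), hpow _ (by positivity),
      mul_div_mul_right _ _ (by positivity)] at h
    rw [Real.rpow_neg hC.le, ← div_eq_mul_inv]
    refine h.congr' ?_
    filter_upwards [(tendsto_jkr hk hkr).eventually_gt_atTop 0] with m hj
    have hj' : (jkr r k m : ℝ) ^ (p - 1) ≠ 0 := by positivity
    simp only [Function.comp_apply, Pi.div_apply]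
    rw [Real.div_rpow (by positivity) (by positivity), hpow _ (by positivity),
      div_div_div_cancel_right₀ hj']
end

section
/- Let k > p ≥ 1 be integers and let f be a function on the natural numbers such that for all positive integers m and n, if C(n, k) ≤ m ≤ C(n+1, k) then C(n, p) ≤ f(m) ≤ C(n+1, p). Then the limit as m → ∞ of f(m) / m^(p/k) exists and equals (k!)^(p/k) / p!. -/
open Filter in
/-- `C(n + a, r) / n ^ r → 1 / r!` as `n → ∞`. -/
theorem tendsto_choose_add_div_pow (a r : ℕ) :
    Tendsto (fun n : ℕ => ((n + a).choose r : ℝ) / (n : ℝ) ^ r) atTop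
      (nhds (1 / (r.factorial : ℝ))) := by
  have h : Tendsto (fun n : ℕ => (n : ℝ) * (1 / ((n : ℝ) - a))) atTop (nhds 1) := by
    rw [← tendsto_add_atTop_iff_nat a]
    have h0 : Tendsto (fun n : ℕ => 1 + (a : ℝ) / n) atTop (nhds (1 + 0)) :=
      tendsto_const_nhds.add (tendsto_const_div_atTop_nhds_zero_nat _)
    rw [add_zero] at h0
    refine h0.congr' ?_
    filter_upwards [eventually_gt_atTop 0] with n hn
    have : (n : ℝ) ≠ 0 := by positivity
    push_cast
    rw [add_sub_cancel_right]
    field_simp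
  have h1 := (ProbabilityTheory.tendsto_choose_mul_pow_atTop r h).comp (tendsto_add_atTop_nat a)
  rw [one_pow] at h1
  refine h1.congr fun n => ?_
  simp [div_eq_mul_inv]

open Filter in
/-- `C(n + a, p) / C(n + b, k) ^ (p / k) → k! ^ (p / k) / p!` as `n → ∞`. -/
theorem tendsto_choose_add_div_choose_add_rpow (a b p : ℕ) {k : ℕ} (hk : k ≠ 0) :
    Tendsto (fun n : ℕ => ((n + a).choose p : ℝ) / ((n + b).choose k : ℝ) ^ ((p : ℝ) / (k : ℝ)))
      atTop (nhds ((k.factorial : ℝ) ^ ((p : ℝ) / (k : ℝ)) / (p.factorial : ℝ))) := by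
  have hk' : (k : ℝ) ≠ 0 := by exact_mod_cast hk
  have hpos : (0 : ℝ) < 1 / (k.factorial : ℝ) := by positivity
  have h := (tendsto_choose_add_div_pow a p).div
    ((tendsto_choose_add_div_pow b k).rpow_const (p := (p : ℝ) / k) (Or.inl hpos.ne'))
    (Real.rpow_pos_of_pos hpos _).ne'
  have hlim : 1 / (p.factorial : ℝ) / (1 / (k.factorial : ℝ)) ^ ((p : ℝ) / (k : ℝ)) =
      (k.factorial : ℝ) ^ ((p : ℝ) / (k : ℝ)) / (p.factorial : ℝ) := by
    rw [Real.div_rpow zero_le_one (by positivity), Real.one_rpow, div_div_eq_mul_div, div_one]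
    ring
  rw [hlim] at h
  refine h.congr' ?_
  filter_upwards [eventually_gt_atTop 0] with n hn
  have hn' : (n : ℝ) ≠ 0 := by positivity
  have hpow : ((n : ℝ) ^ k) ^ ((p : ℝ) / (k : ℝ)) = (n : ℝ) ^ p := by
    rw [← Real.rpow_natCast, ← Real.rpow_mul n.cast_nonneg, mul_div_cancel₀ _ hk',
      Real.rpow_natCast]
  simp only [Pi.div_apply]
  rw [Real.div_rpow (by positivity) (by positivity), hpow,
    div_div_div_cancel_right₀ (pow_ne_zero _ hn')]

theorem lt_choose_add_self {k : ℕ} (hk : k ≠ 0) (m : ℕ) : m < (m + k).choose k := by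
  induction m with
  | zero => simp
  | succ m ih =>
    have h := Nat.choose_eq_choose_pred_add (n := m + 1 + k) (by omega) (Nat.pos_of_ne_zero hk)
    rw [show m + 1 + k - 1 = m + k by omega] at h
    have := Nat.choose_pos (n := m + k) (k := k - 1) (by omega)
    omega

/-- Every positive `m` lies between two consecutive binomial coefficients `C(n, k)`. -/
theorem exists_choose_le_lt_choose_succ {k m : ℕ} (hk : k ≠ 0) (hm : 0 < m) :
    ∃ n, k ≤ n ∧ n.choose k ≤ m ∧ m < (n + 1).choose k := by
  have hex : ∃ n : ℕ, m < n.choose k := ⟨m + k, lt_choose_add_self hk m⟩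
  have hlt : k < Nat.find hex := by
    by_contra! h
    have := (Nat.find_spec hex).trans_le (Nat.choose_le_choose k h)
    rw [Nat.choose_self] at this
    omega
  refine ⟨Nat.find hex - 1, by omega, not_lt.1 (Nat.find_min hex (by omega)), ?_⟩
  rw [Nat.sub_add_cancel (by omega)]
  exact Nat.find_spec hex

open Filter in
/-- Let `k > p ≥ 1` be integers and let `f` be a function on the natural
numbers such that for all positive integers `m` and `n`, if `C(n, k) ≤ m ≤ C(n+1, k)` then
`C(n, p) ≤ f(m) ≤ C(n+1, p)`.  Then `f(m) / m^(p/k) → (k!)^(p/k) / p!` as `m → ∞`. -/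
theorem stmt_15 (k p : ℕ) (hp : 1 ≤ p) (hpk : p < k) (f : ℕ → ℝ)
    (hf : ∀ m n : ℕ, 0 < m → 0 < n → Nat.choose n k ≤ m → m ≤ Nat.choose (n + 1) k →
      (Nat.choose n p : ℝ) ≤ f m ∧ f m ≤ (Nat.choose (n + 1) p : ℝ)) :
    Tendsto (fun m : ℕ => f m / (m : ℝ) ^ ((p : ℝ) / (k : ℝ))) atTop
      (nhds ((Nat.factorial k : ℝ) ^ ((p : ℝ) / (k : ℝ)) / (Nat.factorial p : ℝ))) := by
  have hk : k ≠ 0 := by omega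
  choose! N hkN hle hlt using fun m (hm : 0 < m) => exists_choose_le_lt_choose_succ hk hm
  have hN : Tendsto N atTop atTop := by
    refine tendsto_atTop.2 fun b => ?_
    filter_upwards [eventually_ge_atTop (b.choose k), eventually_gt_atTop 0] with m hb hm
    by_contra! h
    exact absurd (hlt m hm) (not_lt.2 ((Nat.choose_mono k h).trans hb))
  have hbounds : ∀ m, 0 < m → ((N m).choose p : ℝ) ≤ f m ∧ f m ≤ ((N m + 1).choose p : ℝ) :=
    fun m hm => hf m (N m) hm (by have := hkN m hm; omega) (hle m hm) (hlt m hm).le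
  refine tendsto_of_tendsto_of_tendsto_of_le_of_le'
    ((tendsto_choose_add_div_choose_add_rpow 0 1 p hk).comp hN)
    ((tendsto_choose_add_div_choose_add_rpow 1 0 p hk).comp hN) ?_ ?_
  all_goals
    filter_upwards [eventually_gt_atTop 0] with m hm
    obtain ⟨hlo, hhi⟩ := hbounds m hm
    have hm' : (0 : ℝ) < m := by exact_mod_cast hm
    simp only [Function.comp_apply, add_zero]
  · have : (m : ℝ) ≤ ((N m + 1).choose k : ℝ) := by exact_mod_cast (hlt m hm).le
    have hf0 : 0 ≤ f m := (Nat.cast_nonneg _).trans hlo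
    gcongr
  · have h1 : ((N m).choose k : ℝ) ≤ m := by exact_mod_cast hle m hm
    have h2 : (0 : ℝ) < ((N m).choose k : ℝ) := by exact_mod_cast Nat.choose_pos (hkN m hm)
    gcongr
end

section
/- Let r ≥ k > p ≥ 1 be integers and let f be a function on the natural numbers such that for all positive integers m and n, if C(nr, k)_r ≤ m ≤ C((n+1)r, k)_r then C(nr, p)_r ≤ f(m) ≤ C((n+1)r, p)_r. Then the limit as m → ∞ of f(m) / m^(p/k) exists and equals C(r, p) · C(r, k)^(−p/k). -/
/-- The number of finsets on which `g` is injective with image `T` is the product of the sizes of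
the fibers of `g` over `T`. -/
theorem card_filter_image_eq_injOn {α β : Type*} [Fintype α] [DecidableEq α] [DecidableEq β]
    (g : α → β) (T : Finset β) [DecidablePred fun s : Finset α => s.image g = T ∧ Set.InjOn g s] :
    (Finset.univ.filter fun s : Finset α => s.image g = T ∧ Set.InjOn g s).card =
      ∏ b ∈ T, (Finset.univ.filter fun a => g a = b).card := by
  rw [← Finset.card_pi]
  symm
  refine Finset.card_bij (fun f _ => T.attach.image fun x => f x.1 x.2) ?_ ?_ ?_
  · intro f hf
    have hf' : ∀ b (hb : b ∈ T), g (f b hb) = b := by simpa using hf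
    simp only [Finset.mem_filter, Finset.mem_univ, true_and]
    constructor
    · ext b
      simp [hf']
    · intro a ha a' ha' h
      simp only [Finset.coe_image, Set.mem_image, SetLike.mem_coe, Finset.mem_attach, true_and,
        Subtype.exists] at ha ha'
      obtain ⟨b, hb, rfl⟩ := ha
      obtain ⟨b', hb', rfl⟩ := ha'
      rw [hf', hf'] at h
      subst h
      rfl
  · intro f hf f' hf' h
    have h1 : ∀ b (hb : b ∈ T), g (f b hb) = b := by simpa using hf
    have h2 : ∀ b (hb : b ∈ T), g (f' b hb) = b := by simpa using hf'
    funext b hb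
    have hmem : f b hb ∈ T.attach.image fun x => f' x.1 x.2 :=
      h ▸ Finset.mem_image.2 ⟨⟨b, hb⟩, Finset.mem_attach _ _, rfl⟩
    obtain ⟨⟨c, hc⟩, -, hcb⟩ := Finset.mem_image.1 hmem
    have : c = b := by rw [← h2 c hc, ← h1 b hb]; exact congrArg g hcb
    subst this
    exact hcb.symm
  · intro s hs
    simp only [Finset.mem_filter, Finset.mem_univ, true_and] at hs
    obtain ⟨rfl, hinj⟩ := hs
    have hex : ∀ b ∈ s.image g, ∃ a ∈ s, g a = b := fun b hb => Finset.mem_image.1 hb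
    choose f hfs hfg using hex
    refine ⟨f, by simpa using hfg, ?_⟩
    ext a
    simp only [Finset.mem_image, Finset.mem_attach, true_and, Subtype.exists]
    constructor
    · rintro ⟨b, hb, rfl⟩
      exact hfs _ _
    · intro ha
      have hga : g a ∈ s.image g := Finset.mem_image_of_mem g ha
      exact ⟨g a, Finset.mem_image.1 hga, hinj (hfs _ hga) ha (hfg _ hga)⟩

theorem card_filter_fin_mul_mod_eq (n r b : ℕ) (hb : b < r) :
    (Finset.univ.filter fun a : Fin (n * r) => (a : ℕ) % r = b).card = n := by
  have heq : (Finset.univ.filter fun a : Fin (n * r) => (a : ℕ) % r = b) =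
      Finset.univ.image fun i : Fin n => finProdFinEquiv (i, (⟨b, hb⟩ : Fin r)) := by
    ext a
    simp only [Finset.mem_filter, Finset.mem_univ, true_and, Finset.mem_image]
    constructor
    · rintro rfl
      exact ⟨a.divNat, finProdFinEquiv.apply_symm_apply a⟩
    · rintro ⟨i, rfl⟩
      simp [Nat.mod_eq_of_lt hb]
  have hinj : Function.Injective fun i : Fin n => finProdFinEquiv (i, (⟨b, hb⟩ : Fin r)) :=
    fun i j h => (Prod.ext_iff.1 (finProdFinEquiv.injective h)).1
  rw [heq, Finset.card_image_of_injective _ hinj, Finset.card_univ, Fintype.card_fin]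

/-- The Turán graph with `r` parts of size `n` has `C(r, k) * n ^ k` cliques on `k` vertices. -/
theorem tc_mul (n k r : ℕ) (hr : 0 < r) : tc (n * r) k r = r.choose k * n ^ k := by
  classical
  let g : Fin (n * r) → ℕ := fun a => (a : ℕ) % r
  have hclique : (SimpleGraph.turanGraph (n * r) r).cliqueSet k =
      ((Finset.univ.filter fun s : Finset (Fin (n * r)) => Set.InjOn g s ∧ s.card = k :
        Finset (Finset (Fin (n * r)))) : Set (Finset (Fin (n * r)))) := by
    ext s
    simp only [SimpleGraph.mem_cliqueSet_iff, SimpleGraph.isNClique_iff, SimpleGraph.isClique_iff,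
      Finset.coe_filter, Finset.mem_univ, true_and, Set.mem_ofPred_eq]
    refine and_congr_left fun _ => ?_
    constructor
    · intro h a ha b hb hab
      by_contra hne
      exact h ha hb hne hab
    · intro h a ha b hb hne hab
      exact hne (h ha hb hab)
  have hmaps : ∀ s ∈ (Finset.univ.filter fun s : Finset (Fin (n * r)) =>
      Set.InjOn g s ∧ s.card = k), s.image g ∈ (Finset.range r).powersetCard k := by
    intro s hs
    simp only [Finset.mem_filter, Finset.mem_univ, true_and] at hs
    rw [Finset.mem_powersetCard, Finset.card_image_of_injOn hs.1]
    refine ⟨fun b hb => ?_, hs.2⟩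
    obtain ⟨a, -, rfl⟩ := Finset.mem_image.1 hb
    exact Finset.mem_range.2 (Nat.mod_lt _ hr)
  rw [tc, hclique, Set.ncard_coe_finset, Finset.card_eq_sum_card_fiberwise hmaps]
  have hfiber : ∀ T ∈ (Finset.range r).powersetCard k,
      ((Finset.univ.filter fun s : Finset (Fin (n * r)) =>
        Set.InjOn g s ∧ s.card = k).filter fun s => s.image g = T).card = n ^ k := by
    intro T hT
    rw [Finset.mem_powersetCard] at hT
    have heq : ((Finset.univ.filter fun s : Finset (Fin (n * r)) =>
        Set.InjOn g s ∧ s.card = k).filter fun s => s.image g = T) =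
        Finset.univ.filter fun s : Finset (Fin (n * r)) => s.image g = T ∧ Set.InjOn g s := by
      ext s
      simp only [Finset.mem_filter, Finset.mem_univ, true_and]
      constructor
      · rintro ⟨⟨h, -⟩, h'⟩
        exact ⟨h', h⟩
      · rintro ⟨h', h⟩
        exact ⟨⟨h, by rw [← Finset.card_image_of_injOn h, h', hT.2]⟩, h'⟩
    rw [heq, card_filter_image_eq_injOn, Finset.prod_congr rfl fun b hb =>
      card_filter_fin_mul_mod_eq n r b (Finset.mem_range.1 (hT.1 hb)), Finset.prod_const, hT.2]
  rw [Finset.sum_congr rfl hfiber, Finset.sum_const, Finset.card_powersetCard, Finset.card_range,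
    smul_eq_mul]

open Filter in
/-- Let `r ≥ k > p ≥ 1` be integers and let `f` be a function on the
natural numbers such that for all positive integers `m` and `n`, if
`C(nr, k)_r ≤ m ≤ C((n+1)r, k)_r` then `C(nr, p)_r ≤ f(m) ≤ C((n+1)r, p)_r`.  Then
`f(m) / m^(p/k) → C(r, p) · C(r, k)^(−p/k)` as `m → ∞`. -/
theorem stmt_16 (r k p : ℕ) (hp : 1 ≤ p) (hpk : p < k) (hkr : k ≤ r) (f : ℕ → ℝ)
    (hf : ∀ m n : ℕ, 0 < m → 0 < n → tc (n * r) k r ≤ m → m ≤ tc ((n + 1) * r) k r →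
      (tc (n * r) p r : ℝ) ≤ f m ∧ f m ≤ (tc ((n + 1) * r) p r : ℝ)) :
    Tendsto (fun m : ℕ => f m / (m : ℝ) ^ ((p : ℝ) / (k : ℝ))) atTop
      (nhds ((Nat.choose r p : ℝ) * (Nat.choose r k : ℝ) ^ (-((p : ℝ) / (k : ℝ))))) := by
  have hr : 0 < r := by omega
  have hk : (0 : ℝ) < k := by exact_mod_cast (by omega : 0 < k)
  have hA : (0 : ℝ) < (r.choose k : ℝ) := by exact_mod_cast Nat.choose_pos hkr
  simp only [tc_mul _ _ _ hr] at hf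
  set A : ℝ := (r.choose k : ℝ) with hAdef
  set B : ℝ := (r.choose p : ℝ)
  have hB : 0 ≤ B := Nat.cast_nonneg _
  let x : ℕ → ℝ := fun m => ((m : ℝ) / A) ^ (1 / (k : ℝ))
  have hx : Tendsto x atTop atTop :=
    (tendsto_rpow_atTop (by positivity)).comp
      (tendsto_natCast_atTop_atTop.atTop_div_const hA)
  have hxk (m : ℕ) : A * x m ^ k = m := by
    have : x m ^ k = (m : ℝ) / A := by
      simp only [x, one_div]
      exact Real.rpow_inv_natCast_pow (by positivity) (by omega)
    rw [this]
    field_simp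
  have hxp (m : ℕ) : (m : ℝ) ^ ((p : ℝ) / k) = A ^ ((p : ℝ) / k) * x m ^ p := by
    have hx0 : 0 ≤ x m := by positivity
    conv_lhs => rw [← hxk m]
    rw [Real.mul_rpow hA.le (by positivity), ← Real.rpow_natCast (x m) k, ← Real.rpow_mul hx0,
      mul_div_cancel₀ _ hk.ne', Real.rpow_natCast]
  have hfloor : Tendsto (fun m => (⌊x m⌋₊ : ℝ) / x m) atTop (nhds 1) :=
    (tendsto_nat_floor_div_atTop (R := ℝ)).comp hx
  have hfloor_succ : Tendsto (fun m => ((⌊x m⌋₊ : ℝ) + 1) / x m) atTop (nhds 1) := by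
    simpa [add_div] using hfloor.add (tendsto_inv_atTop_zero.comp hx)
  have hbound : ∀ᶠ m in atTop,
      B * A ^ (-((p : ℝ) / k)) * ((⌊x m⌋₊ : ℝ) / x m) ^ p ≤ f m / (m : ℝ) ^ ((p : ℝ) / k) ∧
      f m / (m : ℝ) ^ ((p : ℝ) / k) ≤
        B * A ^ (-((p : ℝ) / k)) * (((⌊x m⌋₊ : ℝ) + 1) / x m) ^ p := by
    filter_upwards [hx.eventually_ge_atTop 1, eventually_gt_atTop 0] with m hm1 hm0
    have hx0 : 0 < x m := by linarith
    have hlow : r.choose k * ⌊x m⌋₊ ^ k ≤ m := by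
      have : (r.choose k : ℝ) * (⌊x m⌋₊ : ℝ) ^ k ≤ m := by
        rw [← hAdef, ← hxk m]
        gcongr
        exact Nat.floor_le hx0.le
      exact_mod_cast this
    have hupp : m ≤ r.choose k * (⌊x m⌋₊ + 1) ^ k := by
      have : (m : ℝ) ≤ (r.choose k : ℝ) * ((⌊x m⌋₊ : ℝ) + 1) ^ k := by
        rw [← hAdef, ← hxk m]
        gcongr
        exact (Nat.lt_floor_add_one _).le
      exact_mod_cast this
    obtain ⟨h1, h2⟩ := hf m ⌊x m⌋₊ hm0 (Nat.floor_pos.2 hm1) hlow hupp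
    push_cast at h1 h2
    have hAp : 0 < A ^ ((p : ℝ) / k) := Real.rpow_pos_of_pos hA _
    have hscale (y : ℝ) : B * A ^ (-((p : ℝ) / k)) * (y / x m) ^ p =
        B * y ^ p / (A ^ ((p : ℝ) / k) * x m ^ p) := by
      rw [Real.rpow_neg hA.le, div_pow]
      field_simp
    rw [hxp, hscale, hscale]
    exact ⟨by gcongr, by gcongr⟩
  refine tendsto_of_tendsto_of_tendsto_of_le_of_le' ?_ ?_ (hbound.mono fun _ h => h.1)
    (hbound.mono fun _ h => h.2)
  · simpa using (hfloor.pow p).const_mul (B * A ^ (-((p : ℝ) / k)))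
  · simpa using (hfloor_succ.pow p).const_mul (B * A ^ (-((p : ℝ) / k)))
end

section
/- Given positive integers m and k with k ≥ 3, there is a unique way to pick an integer s ≥ 0 and integers n_k, n_{k-1}, a_{k-1}, a_{k-2}, ..., a_{k-s} such that m = C(n_k, k) + C(n_{k-1}, k-1) + C(a_{k-1}, k-1) + C(a_{k-2}, k-2) + ... + C(a_{k-s}, k-s), with n_k > n_{k-1}, with a_{k-1} > a_{k-2} > ... > a_{k-s} ≥ k-s > 0, and with C(n_{k-1}, k-2) > C(a_{k-1}, k-1) + C(a_{k-2}, k-2) + ... + C(a_{k-s}, k-s). -/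
/-- For `t ≥ 1`, the intervals `[C(n, t), C(n + 1, t))` cover the natural numbers. -/
lemma exists_choose_le_lt (t r : ℕ) (ht : 0 < t) :
    ∃ n, n.choose t ≤ r ∧ r < (n + 1).choose t := by
  have hex : ∃ n, r < (n + 1).choose t := by
    refine ⟨r + t, ?_⟩
    have h1 : (r + t + 1).choose t = (r + t + 1).choose (r + 1) :=
      Nat.choose_symm_of_eq_add (by omega)
    have h2 : (r + 2).choose (r + 1) ≤ (r + t + 1).choose (r + 1) :=
      Nat.choose_le_choose _ (by omega)
    have h3 : (r + 2).choose (r + 1) = r + 2 := Nat.choose_succ_self_right (r + 1)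
    omega
  classical
  refine ⟨Nat.find hex, ?_, Nat.find_spec hex⟩
  rcases h : Nat.find hex with _ | n
  · rw [Nat.choose_eq_zero_of_lt ht]
    exact Nat.zero_le r
  · exact not_lt.mp (Nat.find_min hex (m := n) (by omega))

/-- The intervals `[C(n, t), C(n + 1, t))` are pairwise disjoint. -/
lemma eq_of_choose_le_lt {t r n n' : ℕ} (h1 : n.choose t ≤ r) (h2 : r < (n + 1).choose t)
    (h1' : n'.choose t ≤ r) (h2' : r < (n' + 1).choose t) : n = n' := by
  rcases lt_trichotomy n n' with h | h | h
  · have := Nat.choose_le_choose t (show n + 1 ≤ n' from h)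
    omega
  · exact h
  · have := Nat.choose_le_choose t (show n' + 1 ≤ n from h)
    omega

lemma lt_of_choose_lt_choose {t a b : ℕ} (h : a.choose t < b.choose t) : a < b := by
  by_contra! hle
  exact absurd (Nat.choose_le_choose t hle) (by omega)

/-- `r = C(a 1, k - 1) + ⋯ + C(a s, k - s)` with `a 1 > ⋯ > a s ≥ k - s > 0`:
a cascade representation of `r` in degree `k - 1`. -/
structure IsCascade (k r s : ℕ) (a : ℕ → ℕ) : Prop where
  eq_sum : r = ∑ i ∈ Finset.Icc 1 s, (a i).choose (k - i)
  anti : ∀ i j, 1 ≤ i → i < j → j ≤ s → a j < a i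
  last : 1 ≤ s → k - s ≤ a s ∧ s < k

lemma sum_Icc_one_succ (f : ℕ → ℕ) (s : ℕ) :
    ∑ i ∈ Finset.Icc 1 (s + 1), f i = f 1 + ∑ i ∈ Finset.Icc 1 s, f (i + 1) := by
  induction s with
  | zero => simp
  | succ s ih =>
    rw [Finset.sum_Icc_succ_top (by omega), ih, Finset.sum_Icc_succ_top (by omega), add_assoc]

namespace IsCascade

lemma zero (k : ℕ) (a : ℕ → ℕ) : IsCascade k 0 0 a :=
  ⟨by simp, by intros; omega, by omega⟩

lemma eq_zero {k r : ℕ} {a : ℕ → ℕ} (h : IsCascade k r 0 a) : r = 0 := by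
  simpa using h.eq_sum

lemma tail {k r s : ℕ} {a : ℕ → ℕ} (h : IsCascade (k + 1) r (s + 1) a) :
    ∃ r', r = (a 1).choose k + r' ∧ IsCascade k r' s (fun i => a (i + 1)) := by
  refine ⟨_, ?_, rfl, ?_, ?_⟩
  · rw [h.eq_sum, sum_Icc_one_succ]
    simp [Nat.add_sub_add_right]
  · intro i j hi hij hj
    exact h.anti _ _ (by omega) (by omega) (by omega)
  · intro hs
    have := h.last (by omega)
    rw [Nat.add_sub_add_right] at this
    exact ⟨this.1, by omega⟩

lemma cons {k r s n : ℕ} {a : ℕ → ℕ} (h : IsCascade k r s a) (hk : 0 < k) (hn : k ≤ n)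
    (ha : 1 ≤ s → a 1 < n) :
    IsCascade (k + 1) (n.choose k + r) (s + 1) (fun i => if i = 1 then n else a (i - 1)) := by
  refine ⟨?_, ?_, ?_⟩
  · rw [sum_Icc_one_succ, h.eq_sum]
    congr 1
    refine Finset.sum_congr rfl fun i hi => ?_
    have := (Finset.mem_Icc.mp hi).1
    rw [if_neg (by omega), Nat.add_sub_cancel, Nat.add_sub_add_right]
  · intro i j hi hij hj
    rw [if_neg (by omega)]
    have hle : a (j - 1) ≤ a 1 := by
      rcases eq_or_ne (j - 1) 1 with e | e
      · rw [e]
      · exact (h.anti 1 (j - 1) le_rfl (by omega) (by omega)).le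
    split_ifs with e
    · exact hle.trans_lt (ha (by omega))
    · exact h.anti _ _ (by omega) (by omega) (by omega)
  · intro _
    rcases Nat.eq_zero_or_pos s with rfl | hs
    · simp only [zero_add, if_true]
      omega
    · have := h.last hs
      rw [if_neg (by omega), Nat.add_sub_cancel]
      omega

lemma bounds {k : ℕ} : ∀ {r s : ℕ} {a : ℕ → ℕ}, IsCascade (k + 1) r (s + 1) a →
    0 < k ∧ k ≤ a 1 ∧ (a 1).choose k ≤ r ∧ r < (a 1 + 1).choose k := by
  induction k with
  | zero =>
    intro r s a h
    have := h.last (by omega)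
    omega
  | succ k ih =>
    intro r s a h
    obtain ⟨r', rfl, h'⟩ := h.tail
    rcases s with _ | s
    · have hr := h'.eq_zero
      have hl : k + 1 + 1 - 1 ≤ a 1 ∧ 1 < k + 1 + 1 := by simpa using h.last (by omega)
      have hp : 0 < (a 1).choose k := Nat.choose_pos (by omega)
      have := Nat.choose_succ_succ' (a 1) k
      refine ⟨by omega, by omega, by omega, by omega⟩
    · obtain ⟨_, h2, _, h4⟩ := ih h'
      have hlt : a 2 < a 1 := h.anti 1 2 le_rfl (by omega) (by omega)
      have hle : (a 2 + 1).choose k ≤ (a 1).choose k := Nat.choose_le_choose k hlt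
      have := Nat.choose_succ_succ' (a 1) k
      simp only [Nat.reduceAdd] at h2 h4
      refine ⟨by omega, by omega, by omega, by omega⟩

lemma pos {k r s : ℕ} {a : ℕ → ℕ} (h : IsCascade (k + 1) r (s + 1) a) : 0 < r := by
  obtain ⟨_, h2, h3, _⟩ := h.bounds
  exact (Nat.choose_pos h2).trans_le h3

lemma exists_cascade (k : ℕ) : ∀ r, ∃ s a, IsCascade (k + 2) r s a := by
  induction k with
  | zero =>
    intro r
    rcases Nat.eq_zero_or_pos r with rfl | hr
    · exact ⟨0, id, zero _ _⟩
    · have := (zero 1 id).cons (n := r) one_pos hr (by omega)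
      rw [Nat.choose_one_right] at this
      exact ⟨_, _, this⟩
  | succ k ih =>
    intro r
    rcases Nat.eq_zero_or_pos r with rfl | hr
    · exact ⟨0, id, zero _ _⟩
    obtain ⟨n, h1, h2⟩ := exists_choose_le_lt (k + 2) r (by omega)
    obtain ⟨r', rfl⟩ := Nat.exists_eq_add_of_le h1
    have hn : k + 2 ≤ n := by
      by_contra! hlt
      have := Nat.choose_le_choose (k + 2) (show n + 1 ≤ k + 2 by omega)
      rw [Nat.choose_self] at this
      omega
    have hp := Nat.choose_succ_succ' n (k + 1)
    simp only [add_assoc, Nat.reduceAdd] at hp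
    obtain ⟨s, a, h⟩ := ih r'
    refine ⟨_, _, h.cons (by omega) hn fun hs => ?_⟩
    obtain ⟨s, rfl⟩ := Nat.exists_eq_add_of_le' hs
    have := h.bounds.2.2.1
    exact lt_of_choose_lt_choose (t := k + 1) (by omega)

lemma unique {k : ℕ} : ∀ {r s s' : ℕ} {a a' : ℕ → ℕ}, IsCascade (k + 1) r s a →
    IsCascade (k + 1) r s' a' → s' = s ∧ ∀ i, 1 ≤ i → i ≤ s → a' i = a i := by
  induction k with
  | zero =>
    intro r s s' a a' h h'
    rcases s with _ | s
    · rcases s' with _ | s'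
      · exact ⟨rfl, by intros; omega⟩
      · exact absurd h'.bounds.1 (lt_irrefl 0)
    · exact absurd h.bounds.1 (lt_irrefl 0)
  | succ k ih =>
    intro r s s' a a' h h'
    rcases s with _ | s <;> rcases s' with _ | s'
    · exact ⟨rfl, by intros; omega⟩
    · exact absurd h.eq_zero h'.pos.ne'
    · exact absurd h'.eq_zero h.pos.ne'
    · obtain ⟨_, _, h3, h4⟩ := h.bounds
      obtain ⟨_, _, h3', h4'⟩ := h'.bounds
      have e := eq_of_choose_le_lt h3' h4' h3 h4
      obtain ⟨q, hq, ht⟩ := h.tail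
      obtain ⟨q', hq', ht'⟩ := h'.tail
      rw [e] at hq'
      obtain rfl : q' = q := by omega
      obtain ⟨rfl, hi⟩ := ih ht ht'
      refine ⟨rfl, fun i h1 h2 => ?_⟩
      rcases eq_or_ne i 1 with rfl | hne
      · exact e
      · have := hi (i - 1) (by omega) (by omega)
        rwa [Nat.sub_add_cancel h1] at this

end IsCascade

/-- If `n₂ < n₁` and `r < C(n₂, k + 1)`, then the sum `C(n₁, k + 3) + C(n₂, k + 2) + r`
determines the brackets of `n₁` and `n₂`. -/
lemma choose_add_choose_add_lt {k n₁ n₂ r : ℕ} (hn : n₂ < n₁) (hr : r < n₂.choose (k + 1)) :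
    n₂.choose (k + 2) + r < (n₂ + 1).choose (k + 2) ∧
      n₁.choose (k + 3) + n₂.choose (k + 2) + r < (n₁ + 1).choose (k + 3) := by
  have h1 := Nat.choose_succ_succ' n₂ (k + 1)
  have h2 := Nat.choose_succ_succ' n₁ (k + 2)
  have h3 := Nat.choose_le_choose (k + 2) (show n₂ + 1 ≤ n₁ from hn)
  simp only [add_assoc, Nat.reduceAdd] at h1 h2
  omega


/-- Given positive integers `m` and `k` with `k ≥ 3`, there is a unique way
to pick an integer `s ≥ 0` and integers `n_k, n_{k-1}, a_{k-1}, a_{k-2}, …, a_{k-s}` such that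
`m = C(n_k, k) + C(n_{k-1}, k-1) + C(a_{k-1}, k-1) + C(a_{k-2}, k-2) + ⋯ + C(a_{k-s}, k-s)`,
with `n_k > n_{k-1}`, `a_{k-1} > a_{k-2} > ⋯ > a_{k-s} ≥ k-s > 0`, and
`C(n_{k-1}, k-2) > C(a_{k-1}, k-1) + C(a_{k-2}, k-2) + ⋯ + C(a_{k-s}, k-s)`.
Here `a i` denotes `a_{k-i}` for `1 ≤ i ≤ s` (there are no `a`-terms when `s = 0`). -/
theorem stmt_17 (m k : ℕ) (hm : 0 < m) (hk : 3 ≤ k) :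
    ∃ (s : ℕ) (n₁ n₂ : ℕ) (a : ℕ → ℕ),
      (m = Nat.choose n₁ k + Nat.choose n₂ (k - 1) +
        ∑ i ∈ Finset.Icc 1 s, Nat.choose (a i) (k - i)) ∧
      n₂ < n₁ ∧
      (∀ i j, 1 ≤ i → i < j → j ≤ s → a j < a i) ∧
      (1 ≤ s → k - s ≤ a s ∧ s < k) ∧
      (∑ i ∈ Finset.Icc 1 s, Nat.choose (a i) (k - i) < Nat.choose n₂ (k - 2)) ∧
      (∀ (s' : ℕ) (n₁' n₂' : ℕ) (a' : ℕ → ℕ),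
        (m = Nat.choose n₁' k + Nat.choose n₂' (k - 1) +
          ∑ i ∈ Finset.Icc 1 s', Nat.choose (a' i) (k - i)) →
        n₂' < n₁' →
        (∀ i j, 1 ≤ i → i < j → j ≤ s' → a' j < a' i) →
        (1 ≤ s' → k - s' ≤ a' s' ∧ s' < k) →
        (∑ i ∈ Finset.Icc 1 s', Nat.choose (a' i) (k - i) < Nat.choose n₂' (k - 2)) →
        s' = s ∧ n₁' = n₁ ∧ n₂' = n₂ ∧ ∀ i, 1 ≤ i → i ≤ s → a' i = a i) := by
  obtain ⟨k, rfl⟩ := Nat.exists_eq_add_of_le' hk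
  obtain ⟨n₁, h1, h2⟩ := exists_choose_le_lt (k + 3) m (by omega)
  obtain ⟨q, rfl⟩ := Nat.exists_eq_add_of_le h1
  obtain ⟨n₂, h3, h4⟩ := exists_choose_le_lt (k + 2) q (by omega)
  obtain ⟨r, rfl⟩ := Nat.exists_eq_add_of_le h3
  obtain ⟨s, a, h⟩ := IsCascade.exists_cascade (k + 1) r
  have e1 := Nat.choose_succ_succ' n₁ (k + 2)
  have e2 := Nat.choose_succ_succ' n₂ (k + 1)
  simp only [add_assoc, Nat.reduceAdd] at e1 e2
  refine ⟨s, n₁, n₂, a, ?_, lt_of_choose_lt_choose (t := k + 2) (by omega), h.anti, h.last, ?_, ?_⟩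
  · rw [← h.eq_sum, ← add_assoc]
    rfl
  · rw [← h.eq_sum, show k + 3 - 2 = k + 1 from rfl]
    omega
  · intro s' n₁' n₂' a' hm' hn' hanti hlast hlt
    have h' : IsCascade (k + 3) _ s' a' := ⟨rfl, hanti, hlast⟩
    set r' := ∑ i ∈ Finset.Icc 1 s', Nat.choose (a' i) (k + 3 - i)
    rw [show k + 3 - 1 = k + 2 from rfl] at hm'
    rw [show k + 3 - 2 = k + 1 from rfl] at hlt
    obtain ⟨b2, b1⟩ := choose_add_choose_add_lt hn' hlt
    obtain rfl : n₁' = n₁ :=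
      eq_of_choose_le_lt (t := k + 3) (by omega) (hm' ▸ b1) h1 h2
    obtain rfl : n₂' = n₂ :=
      eq_of_choose_le_lt (t := k + 2) (r := n₂.choose (k + 2) + r)
        (by omega) (by omega) h3 h4
    obtain rfl : r' = r := by omega
    obtain ⟨hs, ha⟩ := h.unique h'
    exact ⟨hs, rfl, rfl, ha⟩
end
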